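/- arXiv:1901.01567 — 4 statements merged into one kernel-verified Lean document; each statement's English description precedes it below -/
import Mathlib

section
/- Let n > 0 be even and let A_n, B_n be n×n real antisymmetric matrices with B_n A_n = -4 I_n. Then for every scalar λ, Pf(B_n + λ² A_n) = det(B_n + 2λ I_n) / Pf(B_n). -/
open Matrix

/-- The Pfaffian of a `2N × 2N` matrix, defined by
`Pf X = (1/(2^N N!)) ∑_{P ∈ S_{2N}} ε(P) ∏_{l=1}^N X (P(2l-1)) (P(2l))`. -/
noncomputable def Pf {N : ℕ} (X : Matrix (Fin (2 * N)) (Fin (2 * N)) ℝ) : ℝ :=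
  (1 / (2 ^ N * (N.factorial : ℝ))) *
    ∑ P : Equiv.Perm (Fin (2 * N)), ((Equiv.Perm.sign P : ℤ) : ℝ) *
      ∏ l : Fin N, X (P ⟨2 * (l : ℕ), by have := l.isLt; omega⟩)
        (P ⟨2 * (l : ℕ) + 1, by have := l.isLt; omega⟩)

namespace PfAux
open Finset

/-- unnormalised Pfaffian on `Fin N × Fin 2` -/
noncomputable def S {N : ℕ} (X : Matrix (Fin N × Fin 2) (Fin N × Fin 2) ℝ) : ℝ :=
  ∑ P : Equiv.Perm (Fin N × Fin 2), ((Equiv.Perm.sign P : ℤ) : ℝ) *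
      ∏ l : Fin N, X (P (l, 0)) (P (l, 1))

/-- index equivalence -/
def e (N : ℕ) : Fin N × Fin 2 ≃ Fin (2 * N) :=
  finProdFinEquiv.trans (finCongr (mul_comm N 2))

lemma e_zero {N : ℕ} (l : Fin N) : e N (l, 0) = ⟨2 * (l : ℕ), by have := l.isLt; omega⟩ := by
  apply Fin.ext; simp [e, finProdFinEquiv]

lemma e_one {N : ℕ} (l : Fin N) : e N (l, 1) = ⟨2 * (l : ℕ) + 1, by have := l.isLt; omega⟩ := by
  apply Fin.ext; simp [e, finProdFinEquiv]; omega

lemma Pf_eq {N : ℕ} (X : Matrix (Fin (2 * N)) (Fin (2 * N)) ℝ) :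
    Pf X = (1 / (2 ^ N * (N.factorial : ℝ))) * S (X.submatrix (e N) (e N)) := by
  unfold Pf S
  congr 1
  refine Fintype.sum_equiv (e N).symm.permCongr _ _ fun P => ?_
  rw [Equiv.Perm.sign_permCongr]
  congr 1
  refine Finset.prod_congr rfl fun l _ => ?_
  simp [Equiv.permCongr_apply, e_zero, e_one]

lemma S_mul {N : ℕ} (C X : Matrix (Fin N × Fin 2) (Fin N × Fin 2) ℝ) :
    S (Cᵀ * X * C) = C.det * S X := by
  have h1 : ∀ p q, (Cᵀ * X * C) p q =
      ∑ g : Fin 2 → (Fin N × Fin 2), X (g 0) (g 1) * (C (g 0) p * C (g 1) q) := by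
    intro p q
    rw [Fintype.sum_equiv (finTwoArrowEquiv (Fin N × Fin 2)) _
      (fun ab => X ab.1 ab.2 * (C ab.1 p * C ab.2 q)) (fun g => by simp [finTwoArrowEquiv])]
    rw [Fintype.sum_prod_type]
    simp only [Matrix.mul_apply, Matrix.transpose_apply, Finset.sum_mul]
    rw [Finset.sum_comm]
    refine Finset.sum_congr rfl fun a _ => Finset.sum_congr rfl fun b _ => ?_
    ring
  have h2 : ∀ P : Equiv.Perm (Fin N × Fin 2), ∏ l : Fin N, (Cᵀ * X * C) (P (l, 0)) (P (l, 1)) =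
      ∑ f : Fin N × Fin 2 → Fin N × Fin 2,
        (∏ l, X (f (l, 0)) (f (l, 1))) * ∏ i, C (f i) (P i) := by
    intro P
    simp only [h1, Finset.prod_univ_sum, Fintype.piFinset_univ]
    refine Fintype.sum_equiv (Equiv.curry _ _ _).symm _ _ fun f => ?_
    simp [Finset.prod_mul_distrib, Fintype.prod_prod_type, Fin.prod_univ_two]
  have h3 : ∀ f : Fin N × Fin 2 → Fin N × Fin 2,
      ∑ P : Equiv.Perm (Fin N × Fin 2), ((Equiv.Perm.sign P : ℤ) : ℝ) * ∏ i, C (f i) (P i)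
        = (C.submatrix f id).det := by
    intro f
    rw [← Matrix.det_transpose, Matrix.det_apply']
    rfl
  have h4 : S (Cᵀ * X * C) = ∑ f : Fin N × Fin 2 → Fin N × Fin 2,
        (∏ l, X (f (l, 0)) (f (l, 1))) * (C.submatrix f id).det := by
    unfold S
    simp only [h2, ← h3, Finset.mul_sum]
    rw [Finset.sum_comm]
    refine Finset.sum_congr rfl fun a _ => Finset.sum_congr rfl fun b _ => ?_
    ring
  rw [h4, S, Finset.mul_sum]
  symm
  refine Finset.sum_of_injOn (fun P : Equiv.Perm (Fin N × Fin 2) => (P : Fin N × Fin 2 → Fin N × Fin 2))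
    (fun P _ Q _ h => DFunLike.coe_injective h) (by simp) ?_ ?_
  · intro f _ hf
    have : ¬ Function.Injective f := by
      intro hi
      apply hf
      exact ⟨Equiv.ofBijective f (Finite.injective_iff_bijective.mp hi), by simp, rfl⟩
    simp only [Function.Injective, not_forall] at this
    obtain ⟨i, j, hij, hne⟩ := this
    rw [Matrix.det_zero_of_row_eq hne, mul_zero]
    ext k; simp [hij]
  · intro P _
    rw [Matrix.det_permute]
    ring

/-- the 2x2 block -/
def K : Matrix (Fin 2) (Fin 2) ℝ := !![0, 1; -1, 0]

/-- standard symplectic matrix -/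
noncomputable def J (N : ℕ) : Matrix (Fin N × Fin 2) (Fin N × Fin 2) ℝ :=
  Matrix.kroneckerMap (· * ·) (1 : Matrix (Fin N) (Fin N) ℝ) K

lemma det_J (N : ℕ) : (J N).det = 1 := by
  unfold J
  rw [Matrix.det_kronecker]
  simp [K, Matrix.det_fin_two]

lemma J_apply {N : ℕ} (p q : Fin N × Fin 2) : J N p q = if p.1 = q.1 then K p.2 q.2 else 0 := by
  simp [J, Matrix.one_apply]

lemma K_perm (s : Equiv.Perm (Fin 2)) : ((Equiv.Perm.sign s : ℤ) : ℝ) * K (s 0) (s 1) = 1 := by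
  have : s = 1 ∨ s = Equiv.swap 0 1 := by
    revert s; decide
  rcases this with rfl | rfl <;> simp [K]

lemma S_J (N : ℕ) : S (J N) = 2 ^ N * (N.factorial : ℝ) := by
  let φ : Equiv.Perm (Fin N) × (Fin N → Equiv.Perm (Fin 2)) → Equiv.Perm (Fin N × Fin 2) :=
    fun x => (Equiv.prodCongrLeft fun _ => x.1) * (Equiv.prodCongrRight x.2)
  have hφ : ∀ x l a, φ x (l, a) = (x.1 l, x.2 l a) := fun x l a => rfl
  have key : ∑ x : Equiv.Perm (Fin N) × (Fin N → Equiv.Perm (Fin 2)), (1 : ℝ) = S (J N) := by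
    unfold S
    refine Finset.sum_of_injOn φ ?_ (by simp) ?_ ?_
    · intro x _ y _ h
      have h' : ∀ l a, (x.1 l, x.2 l a) = (y.1 l, y.2 l a) := fun l a => by
        rw [← hφ, ← hφ, h]
      refine Prod.ext (Equiv.ext fun l => (Prod.ext_iff.mp (h' l 0)).1) ?_
      funext l
      exact Equiv.ext fun a => (Prod.ext_iff.mp (h' l a)).2
    · intro P _ hP
      by_contra hne
      apply hP
      have hprod := (mul_ne_zero_iff.mp hne).2
      rw [Finset.prod_ne_zero_iff] at hprod
      have h1 : ∀ l, (P (l, 0)).1 = (P (l, 1)).1 := by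
        intro l
        by_contra hc
        exact hprod l (mem_univ _) (by rw [J_apply, if_neg hc])
      have h1' : ∀ l a, (P (l, a)).1 = (P (l, 0)).1 := by
        intro l a
        fin_cases a
        · rfl
        · exact (h1 l).symm
      have hs : Function.Surjective (fun l => (P (l, 0)).1) := by
        intro m
        refine ⟨(P.symm (m, 0)).1, ?_⟩
        have := h1' (P.symm (m, 0)).1 (P.symm (m, 0)).2
        simp only [Prod.mk.eta, Equiv.apply_symm_apply] at this
        exact this.symm
      have hi : ∀ l, Function.Injective (fun a => (P (l, a)).2) := by
        intro l a b hab
        have : P (l, a) = P (l, b) := Prod.ext ((h1' l a).trans (h1' l b).symm) hab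
        exact (Prod.ext_iff.mp (P.injective this)).2
      refine ⟨(Equiv.ofBijective _ (Finite.surjective_iff_bijective.mp hs),
        fun l => Equiv.ofBijective _ (Finite.injective_iff_bijective.mp (hi l))), by simp, ?_⟩
      refine Equiv.ext fun ⟨l, a⟩ => ?_
      rw [hφ]
      exact Prod.ext (h1' l a).symm rfl
    · intro x _
      have hsg : Equiv.Perm.sign (φ x) = ∏ l, Equiv.Perm.sign (x.2 l) := by
        simp only [φ, Equiv.Perm.sign_mul]
        rw [Equiv.Perm.sign_prodCongrLeft, Equiv.Perm.sign_prodCongrRight]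
        simp
      rw [hsg]
      push_cast
      rw [← Finset.prod_mul_distrib]
      symm
      refine Finset.prod_eq_one fun l _ => ?_
      rw [hφ, hφ, J_apply, if_pos rfl]
      exact K_perm _
  rw [← key]
  simp [Fintype.card_perm, mul_comm]

lemma exists_pairs {ι : Type*} [Fintype ι] [DecidableEq ι] (B A : Matrix ι ι ℝ) (hB : Bᵀ = -B)
    (hAB : A * B = 1) (k : ℕ) (hk : 2 * k ≤ Fintype.card ι) :
    ∃ u v : ℕ → ι → ℝ, ∀ i < k, ∀ j < k, u i ⬝ᵥ B *ᵥ u j = 0 ∧ v i ⬝ᵥ B *ᵥ v j = 0 ∧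
      u i ⬝ᵥ B *ᵥ v j = if i = j then 1 else 0 := by
  have hskew : ∀ x y : ι → ℝ, x ⬝ᵥ B *ᵥ y = - (y ⬝ᵥ B *ᵥ x) := by
    intro x y
    have : B = -Bᵀ := by rw [hB, neg_neg]
    conv_lhs => rw [this]
    rw [Matrix.neg_mulVec, dotProduct_neg, Matrix.mulVec_transpose, dotProduct_comm,
      ← Matrix.dotProduct_mulVec]
  have hself : ∀ x : ι → ℝ, x ⬝ᵥ B *ᵥ x = 0 := fun x => by linarith [hskew x x]
  induction k with
  | zero => exact ⟨0, 0, by simp⟩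
  | succ k ih =>
    obtain ⟨u, v, h⟩ := ih (by omega)
    -- kernel vector
    let F : (ι → ℝ) →ₗ[ℝ] (Fin k ⊕ Fin k → ℝ) :=
      (Matrix.of (Sum.elim (fun i : Fin k => u i) (fun i : Fin k => v i)) * B).mulVecLin
    have hF : LinearMap.ker F ≠ ⊥ := F.ker_ne_bot_of_finrank_lt (by
      simp; omega)
    obtain ⟨x, hxF, hx0⟩ := (Submodule.ne_bot_iff _).mp hF
    rw [LinearMap.mem_ker] at hxF
    have hFx : ∀ s, Sum.elim (fun i : Fin k => u i) (fun i : Fin k => v i) s ⬝ᵥ B *ᵥ x = 0 := by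
      intro s
      have := congrFun hxF s
      simp only [F, Matrix.mulVecLin_apply, ← Matrix.mulVec_mulVec] at this
      exact this
    have hux : ∀ i < k, u i ⬝ᵥ B *ᵥ x = 0 := fun i hi => hFx (Sum.inl ⟨i, hi⟩)
    have hvx : ∀ i < k, v i ⬝ᵥ B *ᵥ x = 0 := fun i hi => hFx (Sum.inr ⟨i, hi⟩)
    have hxu : ∀ i < k, x ⬝ᵥ B *ᵥ u i = 0 := fun i hi => by rw [hskew, hux i hi, neg_zero]
    have hxv : ∀ i < k, x ⬝ᵥ B *ᵥ v i = 0 := fun i hi => by rw [hskew, hvx i hi, neg_zero]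
    have hBx : B *ᵥ x ≠ 0 := by
      intro hc
      apply hx0
      rw [← Matrix.one_mulVec x, ← hAB, ← Matrix.mulVec_mulVec, hc, Matrix.mulVec_zero]
    have hpos : (B *ᵥ x) ⬝ᵥ (B *ᵥ x) ≠ 0 := fun hc => hBx (dotProduct_self_eq_zero.mp hc)
    obtain ⟨y, hy⟩ : ∃ y : ι → ℝ, x ⬝ᵥ B *ᵥ y = 1 := by
      refine ⟨-((B *ᵥ x) ⬝ᵥ (B *ᵥ x))⁻¹ • (B *ᵥ x), ?_⟩
      rw [hskew, smul_dotProduct, smul_eq_mul, neg_mul, neg_neg, inv_mul_cancel₀ hpos]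
    let y' : ι → ℝ := y - ∑ i ∈ range k, ((u i ⬝ᵥ B *ᵥ y) • v i - (v i ⬝ᵥ B *ᵥ y) • u i)
    have hexp : ∀ z : ι → ℝ, z ⬝ᵥ B *ᵥ y' = z ⬝ᵥ B *ᵥ y -
        ∑ i ∈ range k, ((u i ⬝ᵥ B *ᵥ y) * (z ⬝ᵥ B *ᵥ v i) - (v i ⬝ᵥ B *ᵥ y) * (z ⬝ᵥ B *ᵥ u i)) := by
      intro z
      simp only [y', Matrix.mulVec_sub, dotProduct_sub, Matrix.mulVec_sum, dotProduct_sum,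
        Matrix.mulVec_smul, dotProduct_smul, smul_eq_mul]
    have hxy : x ⬝ᵥ B *ᵥ y' = 1 := by
      rw [hexp, hy, Finset.sum_eq_zero, sub_zero]
      intro i hi
      rw [hxu i (mem_range.mp hi), hxv i (mem_range.mp hi)]; ring
    have huy : ∀ j < k, u j ⬝ᵥ B *ᵥ y' = 0 := by
      intro j hj
      rw [hexp, Finset.sum_eq_single_of_mem j (mem_range.mpr hj)]
      · rw [(h j hj j hj).2.2, (h j hj j hj).1]; simp
      · intro i hi hij
        rw [(h j hj i (mem_range.mp hi)).2.2, (h j hj i (mem_range.mp hi)).1, if_neg hij.symm]; ring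
    have hvy : ∀ j < k, v j ⬝ᵥ B *ᵥ y' = 0 := by
      intro j hj
      rw [hexp, Finset.sum_eq_single_of_mem j (mem_range.mpr hj)]
      · rw [(h j hj j hj).2.1, hskew (v j) (u j), (h j hj j hj).2.2]; simp
      · intro i hi hij
        rw [(h j hj i (mem_range.mp hi)).2.1, hskew (v j) (u i),
          (h i (mem_range.mp hi) j hj).2.2, if_neg hij]; ring
    have hyv : ∀ j < k, y' ⬝ᵥ B *ᵥ v j = 0 := fun j hj => by rw [hskew, hvy j hj, neg_zero]
    refine ⟨fun i => if i = k then x else u i, fun i => if i = k then y' else v i, ?_⟩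
    intro i hi j hj
    by_cases hik : i = k <;> by_cases hjk : j = k
    · subst hik; subst hjk
      simp [hself, hxy]
    · subst hik
      have hj' : j < i := by omega
      have : ¬ i = j := fun h => hjk h.symm
      simp [hjk, this, hxu j hj', hxv j hj', hyv j hj']
    · subst hjk
      have hi' : i < j := by omega
      simp [hik, hux i hi', huy i hi', hvy i hi']
    · have hi' : i < k := by omega
      have hj' : j < k := by omega
      simpa [hik, hjk] using h i hi' j hj'

lemma exists_normal {N : ℕ} (B A : Matrix (Fin N × Fin 2) (Fin N × Fin 2) ℝ) (hB : Bᵀ = -B)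
    (hAB : A * B = 1) : ∃ C : Matrix (Fin N × Fin 2) (Fin N × Fin 2) ℝ, Cᵀ * B * C = J N := by
  obtain ⟨u, v, h⟩ := exists_pairs B A hB hAB N (by simp; omega)
  have h4 : ∀ i < N, ∀ j < N, v i ⬝ᵥ B *ᵥ u j = if i = j then -1 else 0 := by
    intro i hi j hj
    have h' : v i ⬝ᵥ B *ᵥ u j = - (u j ⬝ᵥ B *ᵥ v i) := by
      have : B = -Bᵀ := by rw [hB, neg_neg]
      conv_lhs => rw [this]
      rw [Matrix.neg_mulVec, dotProduct_neg, Matrix.mulVec_transpose, dotProduct_comm,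
        ← Matrix.dotProduct_mulVec]
    rw [h', (h j hj i hi).2.2]
    by_cases hij : i = j
    · simp [hij]
    · simp [hij, Ne.symm hij]
  refine ⟨Matrix.of fun r p => (if p.2 = 0 then u p.1 else v p.1) r, ?_⟩
  ext p q
  have : ((Matrix.of fun r p => (if p.2 = 0 then u p.1 else v p.1) r :
      Matrix (Fin N × Fin 2) (Fin N × Fin 2) ℝ)ᵀ * B *
      (Matrix.of fun r p => (if p.2 = 0 then u p.1 else v p.1) r)) p q =
      (if p.2 = 0 then u p.1 else v p.1) ⬝ᵥ B *ᵥ (if q.2 = 0 then u q.1 else v q.1) := by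
    rw [Matrix.mul_assoc]
    rfl
  rw [this, J_apply]
  obtain ⟨i, a⟩ := p
  obtain ⟨j, b⟩ := q
  have hh := h i i.2 j j.2
  have hh4 := h4 i i.2 j j.2
  simp only [Fin.val_inj] at hh hh4
  fin_cases a <;> fin_cases b <;> simp [hh, hh4, K]

lemma Pf_mul {N : ℕ} (C X : Matrix (Fin (2 * N)) (Fin (2 * N)) ℝ) :
    Pf (Cᵀ * X * C) = C.det * Pf X := by
  rw [Pf_eq, Pf_eq, ← Matrix.submatrix_mul_equiv _ _ _ (e N), ← Matrix.submatrix_mul_equiv _ _ _ (e N),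
    ← Matrix.transpose_submatrix, S_mul, Matrix.det_submatrix_equiv_self]
  ring

lemma Pf_sq {N : ℕ} (B A : Matrix (Fin (2 * N)) (Fin (2 * N)) ℝ) (hB : Bᵀ = -B)
    (hAB : A * B = 1) : Pf B ≠ 0 ∧ B.det = Pf B ^ 2 := by
  obtain ⟨C, hC⟩ := exists_normal (B.submatrix (e N) (e N)) (A.submatrix (e N) (e N))
    (by rw [Matrix.transpose_submatrix, hB]; rfl)
    (by rw [Matrix.submatrix_mul_equiv, hAB, Matrix.submatrix_one_equiv])
  have h1 := congrArg S hC
  rw [S_mul, S_J] at h1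
  have h2 := congrArg Matrix.det hC
  rw [Matrix.det_mul, Matrix.det_mul, Matrix.det_transpose, Matrix.det_submatrix_equiv_self,
    det_J] at h2
  have hpos : (2 ^ N * (N.factorial : ℝ)) ≠ 0 := by positivity
  have h3 : C.det * Pf B = 1 := by
    rw [Pf_eq]
    field_simp
    linarith
  refine ⟨fun hc => by simp [hc] at h3, ?_⟩
  have : B.det * (C.det * Pf B) ^ 2 = Pf B ^ 2 := by
    linear_combination Pf B ^ 2 * h2
  rw [h3] at this
  linarith

end PfAux

/-- if `A, B` are antisymmetric of even size `2N > 0` and `B A = -4 I`, then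
`Pf (B + λ² A) = det (B + 2λ I) / Pf B`. -/
theorem stmt3 (N : ℕ) (hN : 0 < N)
    (A B : Matrix (Fin (2 * N)) (Fin (2 * N)) ℝ)
    (hA : Aᵀ = -A) (hB : Bᵀ = -B)
    (hBA : B * A = (-4 : ℝ) • (1 : Matrix (Fin (2 * N)) (Fin (2 * N)) ℝ)) (lam : ℝ) :
    Pf (B + lam ^ 2 • A) = (B + (2 * lam) • (1 : Matrix (Fin (2 * N)) (Fin (2 * N)) ℝ)).det / Pf B := by
  have hBA' : B * (((-1 : ℝ) / 4) • A) = 1 := by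
    rw [Matrix.mul_smul, hBA, smul_smul]; norm_num
  have hAB' := mul_eq_one_comm.mp hBA'
  have hAB : A * B = (-4 : ℝ) • (1 : Matrix (Fin (2 * N)) (Fin (2 * N)) ℝ) := by
    rw [← hAB', Matrix.smul_mul, smul_smul]; norm_num
  obtain ⟨hne, hdet⟩ := PfAux.Pf_sq B _ hB hAB'
  have e1 : Bᵀ * (((1 : ℝ) / 4) • A) * B = B := by
    rw [hB, Matrix.mul_smul, Matrix.neg_mul, hBA, smul_neg, smul_smul]; norm_num
  have e2 : (B + (2 * lam) • (1 : Matrix (Fin (2 * N)) (Fin (2 * N)) ℝ))ᵀ * (((1 : ℝ) / 4) • A) *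
      (B + (2 * lam) • (1 : Matrix (Fin (2 * N)) (Fin (2 * N)) ℝ)) = B + lam ^ 2 • A := by
    rw [Matrix.transpose_add, hB, Matrix.transpose_smul, Matrix.transpose_one]
    simp only [Matrix.mul_add, Matrix.add_mul, Matrix.neg_mul, Matrix.mul_smul, Matrix.smul_mul,
      Matrix.one_mul, Matrix.mul_one, hBA, hAB, smul_add, smul_neg, smul_smul]
    module
  have p1 := PfAux.Pf_mul B (((1 : ℝ) / 4) • A)
  have p2 := PfAux.Pf_mul (B + (2 * lam) • (1 : Matrix (Fin (2 * N)) (Fin (2 * N)) ℝ)) (((1 : ℝ) / 4) • A)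
  rw [e1, hdet] at p1
  rw [e2] at p2
  rw [p2, eq_div_iff hne, mul_assoc]
  have : Pf (((1 : ℝ) / 4) • A) * Pf B = 1 := by
    apply mul_left_cancel₀ hne
    linear_combination -p1
  rw [this, mul_one]
end

section
/- Let m < n, λ_1,...,λ_m ∈ ℝ, F(x) = e^{-x²/2} ∏_{j=1}^m (x - λ_j), and c > 0 with 2nc² < 1. Then (1 - nc²) c² ∫_ℝ |F(x₁)|² dx₁ ≤ ∫_ℝ dx₁ ∫_{x₁-c}^{x₁+c} dx₂ |x₁ - x₂| |F(x₁)| |F(x₂)| ≤ c² ∫_ℝ |F(x₁)|² dx₁. -/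
open MeasureTheory

lemma aux_int (p : Polynomial ℝ) : Integrable (fun x : ℝ => p.eval x * Real.exp (-x ^ 2)) := by
  induction p using Polynomial.induction_on' with
  | add p q hp hq =>
    refine (hp.add hq).congr (Filter.Eventually.of_forall fun x => ?_)
    simp [Polynomial.eval_add, add_mul]
  | monomial n a =>
    have h := (integrable_rpow_mul_exp_neg_mul_sq (b := 1) one_pos (s := (n : ℝ))
      (by have : (0:ℝ) ≤ n := n.cast_nonneg
          linarith)).const_mul a
    refine h.congr (Filter.Eventually.of_forall fun x => ?_)
    simp [Polynomial.eval_monomial, mul_assoc]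

noncomputable def auxI (p : Polynomial ℝ) : ℝ := ∫ x : ℝ, p.eval x * Real.exp (-x ^ 2)

lemma auxI_add (p q : Polynomial ℝ) : auxI (p + q) = auxI p + auxI q := by
  unfold auxI
  rw [← integral_add (aux_int p) (aux_int q)]
  simp [Polynomial.eval_add, add_mul]

lemma auxI_C (a : ℝ) (p : Polynomial ℝ) : auxI (Polynomial.C a * p) = a * auxI p := by
  unfold auxI
  rw [← integral_const_mul]
  simp [mul_assoc]

lemma auxI_sq (p : Polynomial ℝ) : 0 ≤ auxI (p ^ 2) := by
  unfold auxI
  refine integral_nonneg fun x => ?_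
  simp only [Polynomial.eval_pow, Pi.zero_apply]
  positivity

open Polynomial in
lemma auxI_deriv (p : ℝ[X]) : auxI (derivative p) = 2 * auxI (X * p) := by
  have h : auxI (derivative p + C (-2) * (X * p)) = 0 := by
    unfold auxI
    refine integral_eq_zero_of_hasDerivAt_of_integrable
      (f := fun x : ℝ => p.eval x * Real.exp (-x ^ 2)) ?_ (aux_int _) (aux_int _)
    intro x
    have h1 : HasDerivAt (fun x : ℝ => Real.exp (-x ^ 2)) (Real.exp (-x^2) * (-(2 * x))) x := by
      have := ((hasDerivAt_pow 2 x).neg).exp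
      simpa using this
    refine ((p.hasDerivAt x).fun_mul h1).congr_deriv ?_
    simp
    ring
  rw [auxI_add, auxI_C] at h
  linarith

open Polynomial in
lemma aux_bern (m : ℕ) : ∀ p : ℝ[X], p.natDegree ≤ m →
    auxI ((derivative p) ^ 2) ≤ 2 * m * auxI (p ^ 2) := by
  induction m with
  | zero =>
    intro p hp
    have : derivative p = 0 := by
      rw [Polynomial.eq_C_of_natDegree_le_zero hp]; simp
    simp [this, auxI]
  | succ m ih =>
    intro p hp
    set q := derivative p with hq
    have hqd : q.natDegree ≤ m := (natDegree_derivative_le p).trans (by omega)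
    have h1 := ih q hqd
    set r := derivative q with hr
    have h0 := auxI_sq (C (2 * (m + 1 : ℝ)) * p + C (-2) * (X * q) + r)
    have e : (C (2 * (m + 1 : ℝ)) * p + C (-2) * (X * q) + r) ^ 2 =
      C (4 * (m + 1 : ℝ)^2) * p ^ 2 + C (-8 * (m+1:ℝ)) * (X * (p * q)) +
      C (4 * (m+1:ℝ)) * (p * r) + C 4 * (X * (X * q ^ 2)) + C (-4) * (X * (q * r)) + r ^ 2 := by
      simp only [C_mul, C_add, C_neg, C_pow, map_ofNat, map_natCast, C_1]
      ring
    rw [e] at h0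
    simp only [auxI_add, auxI_C] at h0
    have d1 := auxI_deriv (p * q)
    have e1 : derivative (p * q) = q ^ 2 + p * r := by
      rw [derivative_mul, ← hq, ← hr]; ring
    rw [e1, auxI_add] at d1
    have d2 := auxI_deriv (X * q ^ 2)
    have e2 : derivative (X * q ^ 2) = q ^ 2 + C 2 * (X * (q * r)) := by
      rw [derivative_mul, derivative_X, derivative_sq, ← hr]
      ring
    rw [e2, auxI_add, auxI_C] at d2
    have hm : (0:ℝ) < m + 1 := by positivity
    push_cast
    have : 0 ≤ (m + 1 : ℝ) * (2 * (m + 1 : ℝ) * auxI (p ^ 2) - auxI (q ^ 2)) := by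
      nlinarith
    have := nonneg_of_mul_nonneg_right this hm
    linarith

/-- shift lemma -/
lemma aux_shift (g : ℝ → ℝ) (hc : Continuous g) (hg : Integrable g) (t : ℝ) (ν : Measure ℝ)
    [IsFiniteMeasure ν] : Integrable (fun z : ℝ × ℝ => g (z.1 + z.2 * t)) (volume.prod ν) := by
  rw [integrable_prod_iff' (by
    apply Continuous.aestronglyMeasurable; fun_prop)]
  constructor
  · exact Filter.Eventually.of_forall fun y => hg.comp_add_right (y * t)
  · have : (fun y : ℝ => ∫ x : ℝ, ‖g (x + y * t)‖) = fun y => ∫ x : ℝ, ‖g x‖ := by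
      funext y
      exact integral_add_right_eq_self (fun x => ‖g x‖) (y * t)
    simp only [this]
    exact integrable_const _

lemma aux_jensen (f : ℝ → ℝ) (hf : Continuous f) :
    (∫ s in (0:ℝ)..1, f s) ^ 2 ≤ ∫ s in (0:ℝ)..1, f s ^ 2 := by
  set a := ∫ s in (0:ℝ)..1, f s with ha
  have h : 0 ≤ ∫ s in (0:ℝ)..1, (f s - a) ^ 2 :=
    intervalIntegral.integral_nonneg zero_le_one fun x _ => sq_nonneg _
  have e : ∫ s in (0:ℝ)..1, (f s - a) ^ 2 = (∫ s in (0:ℝ)..1, f s ^ 2) - 2 * a * a + a ^ 2 := by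
    have : (fun s => (f s - a)^2) = fun s => (f s ^ 2 - 2 * a * f s) + a ^ 2 := by
      funext s; ring
    rw [this, intervalIntegral.integral_add, intervalIntegral.integral_sub,
      intervalIntegral.integral_const_mul, ← ha]
    · simp
    all_goals exact Continuous.intervalIntegrable (by fun_prop) _ _
  rw [e] at h
  linarith

lemma aux_ftc (F F' : ℝ → ℝ) (hd : ∀ x, HasDerivAt F (F' x) x) (hc : Continuous F')
    (x t : ℝ) : (F (x + t) - F x) ^ 2 ≤ t ^ 2 * ∫ s in (0:ℝ)..1, F' (x + s * t) ^ 2 := by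
  have h : ∫ s in (0:ℝ)..1, F' (x + s * t) * t = F (x + t) - F x := by
    have := intervalIntegral.integral_eq_sub_of_hasDerivAt (a := 0) (b := 1)
      (f := fun s => F (x + s * t)) (f' := fun s => F' (x + s * t) * t)
      (fun s _ => by
        have h1 : HasDerivAt (fun s : ℝ => x + s * t) t s := by
          simpa using ((hasDerivAt_id s).mul_const t).const_add x
        exact (hd (x + s * t)).comp s h1)
      (Continuous.intervalIntegrable (by fun_prop) _ _)
    simpa using this
  have j := aux_jensen (fun s => F' (x + s * t) * t) (by fun_prop)
  rw [h] at j
  refine j.trans (le_of_eq ?_)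
  rw [← intervalIntegral.integral_const_mul]
  congr 1; funext s; ring

lemma aux_trans (F F' : ℝ → ℝ) (hd : ∀ x, HasDerivAt F (F' x) x) (hc : Continuous F')
    (hi : Integrable fun x => F' x ^ 2)
    (hI : ∀ t, Integrable fun x => (F (x + t) - F x) ^ 2) (t : ℝ) :
    ∫ x, (F (x + t) - F x) ^ 2 ≤ t ^ 2 * ∫ x, F' x ^ 2 := by
  have hp := aux_shift (fun x => F' x ^ 2) (by fun_prop) hi t (volume.restrict (Set.Ioc 0 1))
  have h1 : ∫ x, (F (x + t) - F x) ^ 2 ≤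
      ∫ x, t ^ 2 * ∫ s in Set.Ioc (0:ℝ) 1, F' (x + s * t) ^ 2 := by
    refine integral_mono (hI t) (hp.integral_prod_left.const_mul _) fun x => ?_
    have := aux_ftc F F' hd hc x t
    rwa [intervalIntegral.integral_of_le zero_le_one] at this
  refine h1.trans (le_of_eq ?_)
  rw [integral_const_mul, integral_integral_swap hp]
  congr 1
  have : ∀ s : ℝ, ∫ x, F' (x + s * t) ^ 2 = ∫ x, F' x ^ 2 := fun s =>
    integral_add_right_eq_self (fun x => F' x ^ 2) (s * t)
  simp [this]

lemma aux_inner (c x : ℝ) (f : ℝ → ℝ) :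
    ∫ y in Set.Ioo (x - c) (x + c), f y = ∫ t in Set.Ioo (-c) c, f (x + t) := by
  rw [← integral_indicator measurableSet_Ioo, ← integral_indicator measurableSet_Ioo,
    ← integral_add_left_eq_self _ x]
  congr 1
  funext t
  simp only [Set.indicator, Set.mem_Ioo]
  congr 1
  apply propext
  constructor <;> rintro ⟨h1, h2⟩ <;> constructor <;> linarith

lemma aux_abs (c : ℝ) (hc : 0 < c) : ∫ t in Set.Ioo (-c) c, |t| = c ^ 2 := by
  rw [← integral_Ioc_eq_integral_Ioo, ← intervalIntegral.integral_of_le (by linarith),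
    ← intervalIntegral.integral_add_adjacent_intervals (b := 0)
      (continuous_abs.intervalIntegrable _ _) (continuous_abs.intervalIntegrable _ _)]
  have h1 : ∫ t in (-c)..0, |t| = ∫ t in (-c)..0, -t := by
    refine intervalIntegral.integral_congr fun t ht => ?_
    rw [Set.uIcc_of_le (by linarith)] at ht
    exact abs_of_nonpos ht.2
  have h2 : ∫ t in (0:ℝ)..c, |t| = ∫ t in (0:ℝ)..c, t := by
    refine intervalIntegral.integral_congr fun t ht => ?_
    rw [Set.uIcc_of_le (by linarith)] at ht
    exact abs_of_nonneg ht.1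
  rw [h1, h2, intervalIntegral.integral_neg]
  simp
  ring

lemma aux_main (F F' : ℝ → ℝ) (hd : ∀ x, HasDerivAt F (F' x) x) (hcF : Continuous F)
    (hc' : Continuous F')
    (hF2 : Integrable fun x => F x ^ 2) (hi : Integrable fun x => F' x ^ 2)
    (n : ℕ) (hb : ∫ x, F' x ^ 2 ≤ 2 * n * ∫ x, F x ^ 2) (c : ℝ) (hc : 0 < c) :
    (1 - n * c ^ 2) * c ^ 2 * (∫ x : ℝ, (F x) ^ 2) ≤
      (∫ x₁ : ℝ, ∫ x₂ in Set.Ioo (x₁ - c) (x₁ + c), |x₁ - x₂| * |F x₁| * |F x₂|) ∧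
    (∫ x₁ : ℝ, ∫ x₂ in Set.Ioo (x₁ - c) (x₁ + c), |x₁ - x₂| * |F x₁| * |F x₂|) ≤
      c ^ 2 * ∫ x : ℝ, (F x) ^ 2 := by
  have hs : ∀ t, Integrable fun x => F (x + t) ^ 2 := fun t => hF2.comp_add_right t
  have hse : ∀ t, ∫ x, F (x + t) ^ 2 = ∫ x, F x ^ 2 := fun t =>
    integral_add_right_eq_self (fun x => F x ^ 2) t
  have hP : ∀ t, Integrable fun x => |F x| * |F (x + t)| := fun t => by
    refine (hF2.add (hs t)).mono' (Continuous.aestronglyMeasurable (by fun_prop))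
      (Filter.Eventually.of_forall fun x => ?_)
    rw [Real.norm_of_nonneg (by positivity)]
    simp only [Pi.add_apply]
    nlinarith [sq_abs (F x), sq_abs (F (x + t)), sq_nonneg (|F x| - |F (x + t)|),
      sq_nonneg (F x), sq_nonneg (F (x+t))]
  have hI : ∀ t, Integrable fun x => (F (x + t) - F x) ^ 2 := fun t => by
    refine ((hF2.add (hs t)).const_mul 2).mono' (Continuous.aestronglyMeasurable (by fun_prop))
      (Filter.Eventually.of_forall fun x => ?_)
    rw [Real.norm_of_nonneg (by positivity)]
    simp only [Pi.add_apply]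
    nlinarith [sq_nonneg (F x + F (x+t))]
  set A := ∫ x, F x ^ 2 with hA
  have hA0 : 0 ≤ A := integral_nonneg fun x => sq_nonneg _
  -- G bounds
  have hGu : ∀ t, ∫ x, |F x| * |F (x + t)| ≤ A := fun t => by
    have : ∫ x, |F x| * |F (x + t)| ≤ ∫ x, (1/2) * (F x ^ 2 + F (x + t) ^ 2) := by
      refine integral_mono (hP t) ((hF2.add (hs t)).const_mul _) fun x => ?_
      simp only
      nlinarith [sq_abs (F x), sq_abs (F (x + t)), sq_nonneg (|F x| - |F (x + t)|)]
    rw [integral_const_mul, integral_add hF2 (hs t), hse] at this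
    linarith
  have hGl : ∀ t, A - n * t ^ 2 * A ≤ ∫ x, |F x| * |F (x + t)| := fun t => by
    have h1 := aux_trans F F' hd hc' hi hI t
    have h2 : ∫ x, ((1/2) * (F x ^ 2 + F (x + t) ^ 2) - (1/2) * (F (x + t) - F x) ^ 2) ≤
        ∫ x, |F x| * |F (x + t)| := by
      refine integral_mono (((hF2.add (hs t)).const_mul _).sub ((hI t).const_mul _)) (hP t)
        fun x => ?_
      simp only
      rw [← abs_mul]
      refine le_trans (le_of_eq ?_) (le_abs_self _)
      ring
    have h4 : Integrable fun x => (1/2 : ℝ) * (F x ^ 2 + F (x + t) ^ 2) :=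
      (hF2.add (hs t)).const_mul _
    rw [integral_sub h4 ((hI t).const_mul _), integral_const_mul,
      integral_const_mul, integral_add hF2 (hs t), hse] at h2
    have h3 := mul_le_mul_of_nonneg_left hb (sq_nonneg t)
    nlinarith
  -- swap
  have hprod : Integrable (fun z : ℝ × ℝ => |z.2| * (|F z.1| * |F (z.1 + z.2)|))
      (volume.prod (volume.restrict (Set.Ioo (-c) c))) := by
    rw [integrable_prod_iff' (Continuous.aestronglyMeasurable (by fun_prop))]
    constructor
    · exact Filter.Eventually.of_forall fun t => (hP t).const_mul |t|
    · have hm : AEStronglyMeasurable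
          (fun t : ℝ => ∫ x : ℝ, ‖|t| * (|F x| * |F (x + t)|)‖)
          (volume.restrict (Set.Ioo (-c) c)) := by
        have hcont : Continuous (fun z : ℝ × ℝ => ‖|z.1| * (|F z.2| * |F (z.2 + z.1)|)‖) := by
          fun_prop
        exact (hcont.stronglyMeasurable.integral_prod_right
          (ν := (volume : Measure ℝ))).aestronglyMeasurable
      refine (integrable_const (c * A)).mono' hm ?_
      filter_upwards [ae_restrict_mem measurableSet_Ioo] with t ht
      rw [Real.norm_of_nonneg (integral_nonneg fun x => norm_nonneg _)]
      have : ∀ x, ‖|t| * (|F x| * |F (x + t)|)‖ = |t| * (|F x| * |F (x + t)|) := fun x =>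
        Real.norm_of_nonneg (by positivity)
      simp only [this]
      rw [integral_const_mul]
      have htc : |t| ≤ c := abs_le.2 ⟨ht.1.le, ht.2.le⟩
      calc |t| * _ ≤ |t| * A := mul_le_mul_of_nonneg_left (hGu t) (abs_nonneg _)
        _ ≤ c * A := mul_le_mul_of_nonneg_right htc hA0
  have key : (∫ x₁ : ℝ, ∫ x₂ in Set.Ioo (x₁ - c) (x₁ + c), |x₁ - x₂| * |F x₁| * |F x₂|) =
      ∫ t in Set.Ioo (-c) c, |t| * ∫ x, |F x| * |F (x + t)| := by
    have : ∀ x₁ : ℝ, ∫ x₂ in Set.Ioo (x₁ - c) (x₁ + c), |x₁ - x₂| * |F x₁| * |F x₂| =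
        ∫ t in Set.Ioo (-c) c, |t| * (|F x₁| * |F (x₁ + t)|) := fun x => by
      rw [aux_inner]
      simp [mul_assoc]
    simp only [this]
    rw [integral_integral_swap hprod]
    simp only [integral_const_mul]
  rw [key]
  have hint : Integrable (fun t : ℝ => |t| * ∫ x, |F x| * |F (x + t)|)
      (volume.restrict (Set.Ioo (-c) c)) := by
    have := hprod.integral_prod_right
    simpa only [integral_const_mul] using this
  have habs : Integrable (fun t : ℝ => |t|) (volume.restrict (Set.Ioo (-c) c)) :=
    (continuous_abs.integrableOn_Icc (a := -c) (b := c)).mono_set Set.Ioo_subset_Icc_self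
  constructor
  · have : ∫ t in Set.Ioo (-c) c, |t| * ((1 - n * c ^ 2) * A) ≤
        ∫ t in Set.Ioo (-c) c, |t| * ∫ x, |F x| * |F (x + t)| := by
      refine setIntegral_mono_on (habs.mul_const _) hint measurableSet_Ioo fun t ht => ?_
      refine mul_le_mul_of_nonneg_left (le_trans ?_ (hGl t)) (abs_nonneg _)
      have htc : t ^ 2 ≤ c ^ 2 := sq_le_sq' ht.1.le ht.2.le
      have := mul_le_mul_of_nonneg_left htc (mul_nonneg (Nat.cast_nonneg (α := ℝ) n) hA0)
      linarith
    rw [integral_mul_const, aux_abs c hc] at this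
    linarith
  · have : ∫ t in Set.Ioo (-c) c, |t| * ∫ x, |F x| * |F (x + t)| ≤
        ∫ t in Set.Ioo (-c) c, |t| * A := by
      refine integral_mono hint (habs.mul_const _) fun t => ?_
      exact mul_le_mul_of_nonneg_left (hGu t) (abs_nonneg _)
    rwa [integral_mul_const, aux_abs c hc] at this

/-- for `F(x) = e^{-x²/2} ∏_{j=1}^m (x - λ_j)` with `m < n` and `0 < 2nc² < 1`,
`(1-nc²) c² ∫|F|² ≤ ∫ dx₁ ∫_{x₁-c}^{x₁+c} dx₂ |x₁-x₂||F(x₁)||F(x₂)| ≤ c² ∫|F|²`. -/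
theorem stmt11 (m n : ℕ) (hm : 0 < m) (hmn : m < n) (lam : Fin m → ℝ)
    (c : ℝ) (hc : 0 < c) (hnc : 2 * n * c ^ 2 < 1)
    (F : ℝ → ℝ) (hF : F = fun x => Real.exp (-x ^ 2 / 2) * ∏ j, (x - lam j)) :
    (1 - n * c ^ 2) * c ^ 2 * (∫ x : ℝ, (F x) ^ 2) ≤
      (∫ x₁ : ℝ, ∫ x₂ in Set.Ioo (x₁ - c) (x₁ + c), |x₁ - x₂| * |F x₁| * |F x₂|) ∧
    (∫ x₁ : ℝ, ∫ x₂ in Set.Ioo (x₁ - c) (x₁ + c), |x₁ - x₂| * |F x₁| * |F x₂|) ≤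
      c ^ 2 * ∫ x : ℝ, (F x) ^ 2 := by
  obtain ⟨p, hp⟩ : ∃ p : Polynomial ℝ, p = ∏ j, (Polynomial.X - Polynomial.C (lam j)) :=
    ⟨_, rfl⟩
  have hdeg : p.natDegree ≤ m := by
    rw [hp, Polynomial.natDegree_prod_of_monic _ _ fun j _ => Polynomial.monic_X_sub_C _]
    simp
  have hFp : ∀ x, F x = p.eval x * Real.exp (-x ^ 2 / 2) := fun x => by
    rw [hF, hp, Polynomial.eval_prod]
    simp [mul_comm]
  have hexp : ∀ x : ℝ, Real.exp (-x ^ 2 / 2) ^ 2 = Real.exp (-x ^ 2) := fun x => by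
    rw [← Real.exp_nat_mul]; congr 1; push_cast; ring
  obtain ⟨q, hq⟩ : ∃ q : Polynomial ℝ,
    q = Polynomial.derivative p + Polynomial.C (-1) * (Polynomial.X * p) := ⟨_, rfl⟩
  have hd : ∀ x, HasDerivAt F (q.eval x * Real.exp (-x ^ 2 / 2)) x := fun x => by
    have h1 : HasDerivAt (fun x : ℝ => Real.exp (-x ^ 2 / 2)) (Real.exp (-x^2/2) * (-x)) x := by
      have := (((hasDerivAt_pow 2 x).neg).div_const 2).exp
      simpa [neg_div] using this
    rw [funext hFp]
    refine ((p.hasDerivAt x).fun_mul h1).congr_deriv ?_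
    simp [hq]
    ring
  have e1 : ∀ x, F x ^ 2 = (p ^ 2).eval x * Real.exp (-x ^ 2) := fun x => by
    rw [hFp, mul_pow, hexp, Polynomial.eval_pow]
  have e2 : ∀ x : ℝ, (q.eval x * Real.exp (-x ^ 2 / 2)) ^ 2 =
      (q ^ 2).eval x * Real.exp (-x ^ 2) := fun x => by
    rw [mul_pow, hexp, Polynomial.eval_pow]
  have hcF : Continuous F := continuous_iff_continuousAt.2 fun x => (hd x).continuousAt
  refine aux_main F (fun x => q.eval x * Real.exp (-x ^ 2 / 2)) hd hcF
    (by fun_prop) ?_ ?_ n ?_ c hc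
  · simp only [e1]; exact aux_int _
  · simp only [e2]; exact aux_int _
  · simp only [e1, e2]
    change auxI (q ^ 2) ≤ 2 * n * auxI (p ^ 2)
    have b := aux_bern m p hdeg
    have hq2 : q ^ 2 = (Polynomial.derivative p) ^ 2 +
        Polynomial.C (-2) * (Polynomial.X * (p * Polynomial.derivative p)) +
        (Polynomial.X * p) ^ 2 := by
      rw [hq]
      simp only [Polynomial.C_neg, map_ofNat, Polynomial.C_1]
      ring
    rw [hq2]
    simp only [auxI_add, auxI_C]
    have d := auxI_deriv (Polynomial.X * p ^ 2)
    have e : Polynomial.derivative (Polynomial.X * p ^ 2) =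
        p ^ 2 + Polynomial.C 2 * (Polynomial.X * (p * Polynomial.derivative p)) := by
      rw [Polynomial.derivative_mul, Polynomial.derivative_X, Polynomial.derivative_sq]
      ring
    have e' : Polynomial.X * (Polynomial.X * p ^ 2) = (Polynomial.X * p) ^ 2 := by ring
    rw [e, e', auxI_add, auxI_C] at d
    have s1 := auxI_sq (Polynomial.X * p)
    have s2 := auxI_sq p
    have hn : (m : ℝ) + 1 ≤ n := by exact_mod_cast hmn
    nlinarith
end

section
/- Let G_{n₁,n₂} = ∫_{ℝ^{n₁+n₂}} exp(-∑_i q_i λ_i²/2) ∏_{j<k} |λ_j - λ_k|^{q_j q_k} dλ, where q_j = 1 for j ≤ n₁ and q_j = 2 for j > n₁ (the two-component log-gas partition function). Then for all positive integers n, k with n ≥ 2k: G_{n-2k,k} = 2^{-2k} G_n, where G_n = G_{n,0} is the GOE partition function. -/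
open MeasureTheory

/-- The generalized partition function of the two-component log-gas: `n₁` particles of
charge `1` and `n₂` particles of charge `2`,
`G_{n₁,n₂} = ∫_{ℝ^{n₁+n₂}} exp(-∑ qᵢ λᵢ²/2) ∏_{j<k} |λ_j - λ_k|^{q_j q_k} dλ`. -/
noncomputable def Glg (n₁ n₂ : ℕ) : ℝ :=
  ∫ lam : Fin (n₁ + n₂) → ℝ,
    Real.exp (-∑ i : Fin (n₁ + n₂), (if (i : ℕ) < n₁ then (1 : ℝ) else 2) * lam i ^ 2 / 2) *
      ∏ p ∈ Finset.univ.filter (fun p : Fin (n₁ + n₂) × Fin (n₁ + n₂) => p.1 < p.2),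
        |lam p.1 - lam p.2| ^
          ((if (p.1 : ℕ) < n₁ then 1 else 2) * (if (p.2 : ℕ) < n₁ then 1 else 2))

noncomputable section LG

open Polynomial

def lgEv (p : ℝ[X]) (x : ℝ) : ℝ := p.eval x * Real.exp (-x ^ 2 / 2)
def lgD (p : ℝ[X]) : ℝ[X] := derivative p - X * p
def lgX (p : ℝ[X]) : ℝ[X] := X * p
def lgN (p : ℝ[X]) : ℝ[X] := X * derivative p - derivative (derivative p)
def lgH (i : ℕ) : ℝ[X] := (hermite i).map (Int.castRingHom ℝ)
def lgG (p q : ℝ[X]) : ℝ := ∫ x, lgEv p x * lgEv q x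
def lgP {m : ℕ} (x : Fin m → ℝ) : ℝ := ∏ i, ∏ j ∈ Finset.Ioi i, (SignType.sign (x j - x i) : ℝ)
def lgL (m : ℕ) (g : ℕ → ℝ[X]) : ℝ := ∫ x : Fin m → ℝ, (∏ i : Fin m, lgEv (g i) (x i)) * lgP x

def lgExt {N : ℕ} (s : Equiv.Perm (Fin N)) (i : ℕ) : ℕ := if h : i < N then (s ⟨i, h⟩ : ℕ) else i

def lgS (N : ℕ) (L : (ℕ → ℝ[X]) → ℝ) : ℝ :=
  ∑ s : Equiv.Perm (Fin N), ((Equiv.Perm.sign s : ℤ) : ℝ) * L (fun i => lgH (lgExt s i))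

/-! ### facts about the analysis -/

theorem lgL_congr (m : ℕ) (g g' : ℕ → ℝ[X]) (h : ∀ i < m, g i = g' i) : lgL m g = lgL m g' := by
  unfold lgL
  congr 1; ext x; congr 1
  exact Finset.prod_congr rfl fun i _ => by rw [h i i.2]


theorem lg_int_poly (b : ℝ) (hb : 0 < b) (p : ℝ[X]) :
    Integrable (fun x : ℝ => p.eval x * Real.exp (-b * x ^ 2)) := by
  induction p using Polynomial.induction_on' with
  | add p q hp hq =>
    simp only [eval_add, add_mul]; exact hp.add hq
  | monomial n a =>
    have h := integrable_rpow_mul_exp_neg_mul_sq hb (s := n) (by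
      have : (0:ℝ) ≤ n := Nat.cast_nonneg n
      linarith)
    simp only [Real.rpow_natCast] at h
    simp only [eval_monomial, mul_assoc]
    exact h.const_mul a

theorem lgEv_int (p : ℝ[X]) : Integrable (lgEv p) := by
  have := lg_int_poly (1/2) (by norm_num) p
  refine this.congr (Filter.Eventually.of_forall fun x => ?_)
  simp only [lgEv]
  congr 2; ring

theorem lgEv_mul (p q : ℝ[X]) (x : ℝ) :
    lgEv p x * lgEv q x = (p * q).eval x * Real.exp (-1 * x ^ 2) := by
  simp only [lgEv, eval_mul]
  rw [show Real.exp (-1 * x ^ 2) = Real.exp (-x ^ 2 / 2) * Real.exp (-x ^ 2 / 2) by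
    rw [← Real.exp_add]; congr 1; ring]
  ring

theorem lgEv_int2 (p q : ℝ[X]) : Integrable (fun x => lgEv p x * lgEv q x) := by
  simp only [lgEv_mul]
  exact lg_int_poly 1 one_pos _

theorem lgEv_deriv (p : ℝ[X]) (x : ℝ) : HasDerivAt (lgEv p) (lgEv (lgD p) x) x := by
  have h1 := p.hasDerivAt x
  have h2 : HasDerivAt (fun x : ℝ => -x ^ 2 / 2) (-x) x := by
    have := ((hasDerivAt_id x).pow 2).neg.div_const 2
    refine this.congr_deriv ?_
    simp; ring
  have := h1.mul h2.exp
  refine this.congr_deriv ?_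
  simp [lgEv, lgD]; ring

theorem lgEv_cont (p : ℝ[X]) : Continuous (lgEv p) :=
  continuous_iff_continuousAt.2 fun x => (lgEv_deriv p x).continuousAt

theorem lgG_D (p q : ℝ[X]) : lgG (lgD p) q = - lgG p (lgD q) := by
  unfold lgG
  have := integral_mul_deriv_eq_deriv_mul_of_integrable (u := lgEv p) (v := lgEv q)
    (u' := lgEv (lgD p)) (v' := lgEv (lgD q)) (fun x _ => lgEv_deriv p x) (fun x _ => lgEv_deriv q x)
    (lgEv_int2 _ _) (lgEv_int2 _ _) (lgEv_int2 _ _)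
  rw [this, neg_neg]

theorem lgP_eq {m : ℕ} (x : Fin m → ℝ) :
    lgP x = (SignType.sign (Matrix.vandermonde x).det : ℝ) := by
  rw [Matrix.det_vandermonde]
  unfold lgP
  have h (r : ℝ) : (SignType.sign r : ℝ) = ((SignType.castHom (α := ℝ)).toMonoidHom.comp (signHom (α := ℝ)).toMonoidHom) r := rfl
  simp only [h, map_prod]

theorem lg_sgn_le (r : ℝ) : |(SignType.sign r : ℝ)| ≤ 1 := by
  rcases lt_trichotomy r 0 with h | h | h <;> simp [h]

theorem lgP_le {m : ℕ} (x : Fin m → ℝ) : ‖lgP x‖ ≤ 1 := by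
  rw [lgP_eq]; exact lg_sgn_le _

theorem lg_sgn_meas : Measurable (fun r : ℝ => (SignType.sign r : ℝ)) := by
  have : (fun r : ℝ => (SignType.sign r : ℝ)) =
    fun r => Set.indicator (Set.Ioi 0) 1 r - Set.indicator (Set.Iio 0) 1 r := by
    ext r
    rcases lt_trichotomy r 0 with h | h | h <;> simp [h, Set.indicator, not_lt.2 h.le]
  rw [this]
  exact (measurable_one.indicator measurableSet_Ioi).sub (measurable_one.indicator measurableSet_Iio)

theorem lgP_meas {m : ℕ} : Measurable (lgP (m := m)) := by
  unfold lgP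
  refine Finset.measurable_prod _ fun i _ => Finset.measurable_prod _ fun j _ => ?_
  exact lg_sgn_meas.comp ((measurable_pi_apply j).sub (measurable_pi_apply i))

theorem lgL_int (m : ℕ) (g : Fin m → ℝ → ℝ) (hg : ∀ i, Integrable (g i)) {w : (Fin m → ℝ) → ℝ}
    (hw : Measurable w) (hb : ∀ x, ‖w x‖ ≤ 1) :
    Integrable (fun x : Fin m → ℝ => (∏ i : Fin m, g i (x i)) * w x) := by
  have h1 : Integrable (fun x : Fin m → ℝ => ∏ i : Fin m, g i (x i)) :=
    Integrable.fintype_prod hg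
  exact h1.mul_bdd (c := 1) hw.aestronglyMeasurable (Filter.Eventually.of_forall hb)

theorem lgL_add (m : ℕ) (g g1 g2 : ℕ → ℝ[X]) (h0 : g 0 = g1 0 + g2 0)
   (h1 : ∀ i, 0 < i → g i = g1 i) (h2 : ∀ i, 0 < i → g i = g2 i) :
   lgL (m + 1) g = lgL (m + 1) g1 + lgL (m + 1) g2 := by
  unfold lgL
  rw [← integral_add (lgL_int _ _ (fun i => lgEv_int _) lgP_meas lgP_le)
    (lgL_int _ _ (fun i => lgEv_int _) lgP_meas lgP_le)]
  congr 1; ext x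
  simp only [Fin.prod_univ_succ]
  have e1 : ∀ i : Fin m, g (i.succ : Fin (m+1)) = g1 (i.succ : Fin (m+1)) := fun i => h1 _ (by simp)
  have e2 : ∀ i : Fin m, g1 (i.succ : Fin (m+1)) = g2 (i.succ : Fin (m+1)) := fun i => by
    rw [← e1, h2 _ (by simp)]
  simp only [e1, e2, Fin.val_zero, h0]
  simp only [lgEv, eval_add]; ring

theorem lgL_smul (m : ℕ) (c : ℕ → ℝ) (g : ℕ → ℝ[X])  :
   lgL m (fun i => c i • g i) = (∏ i ∈ Finset.range m, c i) * lgL m g := by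
  unfold lgL
  rw [← integral_const_mul]
  congr 1; ext x
  rw [Finset.prod_range, ← mul_assoc, ← Finset.prod_mul_distrib]
  congr 1
  refine Finset.prod_congr rfl fun i _ => ?_
  simp [lgEv, mul_assoc]

theorem lgP_perm {m : ℕ} (σ : Equiv.Perm (Fin m)) (x : Fin m → ℝ) :
    lgP (fun i => x (σ i)) = ((Equiv.Perm.sign σ : ℤ) : ℝ) * lgP x := by
  rw [lgP_eq, lgP_eq]
  have : Matrix.vandermonde (fun i => x (σ i)) = (Matrix.vandermonde x).submatrix σ id := by
    ext i j; simp [Matrix.vandermonde_apply]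
  rw [this, Matrix.det_permute]
  rcases Int.units_eq_one_or (Equiv.Perm.sign σ) with h | h <;> simp [h, Left.sign_neg]

theorem lg_int_perm {m : ℕ} (σ : Equiv.Perm (Fin m)) (F : (Fin m → ℝ) → ℝ) :
    ∫ x : Fin m → ℝ, F (fun i => x (σ i)) = ∫ x, F x := by
  have := (volume_measurePreserving_piCongrLeft (fun _ : Fin m => ℝ) σ.symm).integral_comp' F
  rw [← this]
  congr 1; ext x; congr 1; ext i
  obtain ⟨j, rfl⟩ := σ.symm.surjective i
  simp [MeasurableEquiv.piCongrLeft]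

theorem lgL_swap (m : ℕ) (a b : ℕ) (ha : a < m) (hb : b < m) (hab : a ≠ b) (g : ℕ → ℝ[X]) :
   lgL m (fun i => g (Equiv.swap a b i)) = - lgL m g := by
  unfold lgL
  set σ : Equiv.Perm (Fin m) := Equiv.swap ⟨a, ha⟩ ⟨b, hb⟩ with hσ
  have hs : Equiv.Perm.sign σ = -1 := Equiv.Perm.sign_swap (by simpa using hab)
  have hv : ∀ i : Fin m, Equiv.swap a b (i : ℕ) = (σ i : ℕ) := fun i => by
    rw [hσ, Equiv.swap_apply_def, Equiv.swap_apply_def]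
    simp only [Fin.ext_iff]
    split_ifs <;> rfl
  rw [← integral_neg, ← lg_int_perm σ]
  congr 1; ext x
  have : (∏ i : Fin m, lgEv (g (Equiv.swap a b i)) (x (σ i))) = ∏ i : Fin m, lgEv (g i) (x i) := by
    simp only [hv]
    exact Equiv.prod_comp σ (fun i => lgEv (g i) (x i))
  rw [this, lgP_perm, hs]
  simp

theorem lg_Ioi (f : ℝ[X]) (a : ℝ) : ∫ t in Set.Ioi a, lgEv (lgD f) t = - lgEv f a := by
  have hlim : Filter.Tendsto (lgEv f) Filter.atTop (nhds 0) :=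
    tendsto_zero_of_hasDerivAt_of_integrableOn_Ioi (a := a) (fun x _ => lgEv_deriv f x)
      (lgEv_int _).integrableOn (lgEv_int _).integrableOn
  rw [integral_Ioi_of_hasDerivAt_of_tendsto' (fun x _ => lgEv_deriv f x)
    (lgEv_int _).integrableOn hlim, zero_sub]

theorem lg_prod_sgn_le {ι : Type*} (s : Finset ι) (u : ι → ℝ) :
    ‖∏ y ∈ s, (SignType.sign (u y) : ℝ)‖ ≤ 1 := by
  rw [norm_prod]
  exact Finset.prod_le_one (fun _ _ => norm_nonneg _) fun i _ => lg_sgn_le _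

theorem lg_1d (f : ℝ[X]) (s : Finset ℝ) :
    ∫ t, lgEv (lgD f) t * ∏ y ∈ s, (SignType.sign (y - t) : ℝ) =
      2 * ∑ y ∈ s, lgEv f y * ∏ l ∈ s.erase y, (SignType.sign (l - y) : ℝ) := by
  classical
  induction s using Finset.induction_on_max with
  | empty =>
    simp only [Finset.prod_empty, mul_one, Finset.sum_empty, mul_zero]
    exact integral_eq_zero_of_hasDerivAt_of_integrable (fun x => lgEv_deriv f x) (lgEv_int _) (lgEv_int _)
  | insert a s ha ih =>
    have hna : a ∉ s := fun h => lt_irrefl _ (ha a h)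
    have hmeas : Measurable fun t => ∏ y ∈ s, (SignType.sign (y - t) : ℝ) :=
      Finset.measurable_prod _ fun y _ => lg_sgn_meas.comp (measurable_const.sub measurable_id)
    have hint : Integrable fun t => lgEv (lgD f) t * ∏ y ∈ s, (SignType.sign (y - t) : ℝ) :=
      (lgEv_int _).mul_bdd (c := 1) hmeas.aestronglyMeasurable
        (Filter.Eventually.of_forall fun t => lg_prod_sgn_le _ _)
    have e1 : ∀ᵐ t : ℝ, lgEv (lgD f) t * ∏ y ∈ insert a s, (SignType.sign (y - t) : ℝ) =
        lgEv (lgD f) t * ∏ y ∈ s, (SignType.sign (y - t) : ℝ) -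
        (Set.Ioi a).indicator (fun t => 2 * (-1) ^ s.card * lgEv (lgD f) t) t := by
      have : ∀ᵐ t : ℝ, t ≠ a := by simp [ae_iff]
      filter_upwards [this] with t ht
      rw [Finset.prod_insert hna]
      rcases lt_or_gt_of_ne ht with h | h
      · rw [Set.indicator_of_notMem (by simpa using h.le), sign_pos (by linarith)]
        simp
      · rw [Set.indicator_of_mem (by simpa using h), sign_neg (by linarith)]
        have : ∏ y ∈ s, (SignType.sign (y - t) : ℝ) = (-1) ^ s.card := by
          rw [Finset.prod_congr rfl (g := fun _ => (-1 : ℝ)), Finset.prod_const]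
          intro y hy
          rw [sign_neg (by linarith [ha y hy])]; simp
        rw [this]; simp; ring
    rw [integral_congr_ae e1, integral_sub hint
      (((lgEv_int _).const_mul _).indicator measurableSet_Ioi), ih,
      integral_indicator measurableSet_Ioi, integral_const_mul, lg_Ioi,
      Finset.sum_insert hna, Finset.erase_insert hna]
    have e2 : ∏ l ∈ s, (SignType.sign (l - a) : ℝ) = (-1) ^ s.card := by
      rw [Finset.prod_congr rfl (g := fun _ => (-1 : ℝ)), Finset.prod_const]
      intro y hy
      rw [sign_neg (by linarith [ha y hy])]; simp
    have e3 : ∑ y ∈ s, lgEv f y * ∏ l ∈ (insert a s).erase y, (SignType.sign (l - y) : ℝ) =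
        ∑ y ∈ s, lgEv f y * ∏ l ∈ s.erase y, (SignType.sign (l - y) : ℝ) := by
      refine Finset.sum_congr rfl fun y hy => ?_
      have hya : a ≠ y := fun h => hna (h ▸ hy)
      rw [Finset.erase_insert_of_ne hya, Finset.prod_insert (by simp [hna]),
        sign_pos (by linarith [ha y hy])]
      simp
    rw [e2, e3]; ring

theorem lg_1d' (f : ℝ[X]) {n : ℕ} (y : Fin n → ℝ) (hy : Function.Injective y) :
    ∫ t, lgEv (lgD f) t * ∏ l, (SignType.sign (y l - t) : ℝ) =
      2 * ∑ j, lgEv f (y j) * ∏ l ∈ Finset.univ.erase j, (SignType.sign (y l - y j) : ℝ) := by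
  classical
  have := lg_1d f (Finset.univ.image y)
  simp only [Finset.prod_image hy.injOn, Finset.sum_image hy.injOn] at this
  rw [this]
  congr 1
  refine Finset.sum_congr rfl fun j _ => ?_
  rw [← Finset.image_erase hy, Finset.prod_image hy.injOn]

theorem lg_ae_inj (n : ℕ) : ∀ᵐ y : Fin n → ℝ, Function.Injective y := by
  have h : ∀ p : Fin n × Fin n, ∀ᵐ y : Fin n → ℝ, p.1 ≠ p.2 → y p.1 ≠ y p.2 := by
    rintro ⟨i, j⟩
    by_cases hij : i = j
    · simp [hij]
    have := Measure.addHaar_submodule (volume : Measure (Fin n → ℝ))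
      (LinearMap.ker ((LinearMap.proj i : (Fin n → ℝ) →ₗ[ℝ] ℝ) - LinearMap.proj j)) (by
        intro h
        have h2 : (Pi.single i 1 : Fin n → ℝ) ∈ (⊤ : Submodule ℝ (Fin n → ℝ)) := trivial
        rw [← h] at h2
        simp [Ne.symm hij] at h2)
    rw [ae_iff]
    refine measure_mono_null ?_ this
    intro y hy
    simp [hij] at hy
    simp [hy]
  rw [← ae_all_iff] at h
  filter_upwards [h] with y hy a b hab
  by_contra hne
  exact hy (a, b) hne hab

theorem lgP_cons {n : ℕ} (t : ℝ) (y : Fin n → ℝ) :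
    lgP (Fin.cons t y : Fin (n + 1) → ℝ) = (∏ l, (SignType.sign (y l - t) : ℝ)) * lgP y := by
  unfold lgP
  rw [Fin.prod_univ_succ]
  congr 1
  · rw [Fin.prod_Ioi_zero]; simp
  · refine Finset.prod_congr rfl fun i _ => ?_
    rw [Fin.prod_Ioi_succ]; simp

theorem lg_cons_eq {n : ℕ} (p : ℝ × (Fin n → ℝ)) :
    (MeasurableEquiv.piFinSuccAbove (fun _ : Fin (n+1) => ℝ) 0).symm p = Fin.cons p.1 p.2 := by
  simp [MeasurableEquiv.piFinSuccAbove_symm_apply, Fin.insertNthEquiv]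

theorem lg_split {n : ℕ} (F : (Fin (n + 1) → ℝ) → ℝ) :
    ∫ x, F x = ∫ p : ℝ × (Fin n → ℝ), F (Fin.cons p.1 p.2) := by
  rw [← (volume_preserving_piFinSuccAbove (fun _ : Fin (n+1) => ℝ) 0).symm.integral_comp']
  simp only [lg_cons_eq]

theorem lg_split_int {n : ℕ} (F : (Fin (n + 1) → ℝ) → ℝ) (hF : Integrable F) :
    Integrable (fun p : ℝ × (Fin n → ℝ) => F (Fin.cons p.1 p.2)) := by
  have := ((volume_preserving_piFinSuccAbove (fun _ : Fin (n+1) => ℝ) 0).symm.integrable_comp_emb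
    (MeasurableEquiv.measurableEmbedding _)).2 hF
  simpa only [Function.comp_def, lg_cons_eq] using this

theorem lg_split' {n : ℕ} (F : (Fin (n + 1) → ℝ) → ℝ) (hF : Integrable F) :
    ∫ x, F x = ∫ y : Fin n → ℝ, ∫ t : ℝ, F (Fin.cons t y) := by
  have h := lg_split_int F hF
  rw [lg_split]
  rw [Measure.volume_eq_prod] at h ⊢
  exact integral_prod_symm _ h

theorem lgM1 (f : ℝ[X]) (g : ℕ → ℝ[X]) (h0 : g 0 = lgD f) : lgL 1 g = 0 := by
  unfold lgL
  rw [lg_split' _ (lgL_int _ _ (fun i => lgEv_int _) lgP_meas lgP_le)]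
  have : ∀ y : Fin 0 → ℝ, ∫ t : ℝ, (∏ i : Fin 1, lgEv (g i) ((Fin.cons t y : Fin 1 → ℝ) i)) *
      lgP (Fin.cons t y : Fin 1 → ℝ) = 0 := by
    intro y
    have h := lg_1d f ∅
    simp at h
    simpa [h0, lgP_cons, lgP] using h
  simp only [this, integral_zero]

theorem lg_erase_zero {m : ℕ} (u : Fin (m + 1) → ℝ) :
    ∏ l ∈ Finset.univ.erase 0, u l = ∏ l : Fin m, u l.succ := by
  rw [Fin.univ_succ, Finset.erase_cons, Finset.prod_map]; rfl

theorem lgMj (m : ℕ) (f : ℝ[X]) (g : ℕ → ℝ[X]) (j : Fin (m + 1)) :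
    ∫ y : Fin (m + 1) → ℝ, lgEv f (y j) *
      (∏ l ∈ Finset.univ.erase j, (SignType.sign (y l - y j) : ℝ)) *
        ((∏ i : Fin (m + 1), lgEv (g (i + 1)) (y i)) * lgP y) =
    (if (j : ℕ) = 0 then (1 : ℝ) else -1) *
      (lgG f (g (j + 1)) * lgL m (fun i => g (Equiv.swap 1 ((j : ℕ) + 1) (i + 2)))) := by
  set σ : Equiv.Perm (Fin (m + 1)) := Equiv.swap 0 j with hσ
  have hs : ((Equiv.Perm.sign σ : ℤ) : ℝ) = if (j : ℕ) = 0 then (1 : ℝ) else -1 := by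
    rw [hσ, Equiv.Perm.sign_swap']
    by_cases h : j = 0
    · simp [h]
    · have h' : (j : ℕ) ≠ 0 := fun h2 => h (Fin.ext h2)
      simp [h', Ne.symm h]
  rw [← lg_int_perm σ]
  have key : ∀ᵐ y : Fin (m + 1) → ℝ, lgEv f (y (σ j)) *
      (∏ l ∈ Finset.univ.erase j, (SignType.sign (y (σ l) - y (σ j)) : ℝ)) *
        ((∏ i : Fin (m + 1), lgEv (g (i + 1)) (y (σ i))) * lgP (fun i => y (σ i))) =
      (if (j : ℕ) = 0 then (1 : ℝ) else -1) * ((lgEv f (y 0) * lgEv (g (j + 1)) (y 0)) *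
        ((∏ i : Fin m, lgEv (g (Equiv.swap 1 ((j : ℕ) + 1) (i + 2))) (Fin.tail y i)) *
          lgP (Fin.tail y))) := by
    filter_upwards [lg_ae_inj (m + 1)] with y hy
    have e0 : σ j = 0 := by simp [hσ]
    have e1 : ∏ l ∈ Finset.univ.erase j, (SignType.sign (y (σ l) - y (σ j)) : ℝ) =
        ∏ l : Fin m, (SignType.sign (y l.succ - y 0) : ℝ) := by
      rw [← lg_erase_zero (fun l => (SignType.sign (y l - y 0) : ℝ)), e0]
      refine Finset.prod_bij (fun l _ => σ l) ?_ ?_ ?_ ?_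
      · intro a ha
        simp only [Finset.mem_erase, Finset.mem_univ, and_true] at ha ⊢
        rw [← e0]; exact fun h => ha (σ.injective h)
      · intro a _ b _ h; exact σ.injective h
      · intro b hb
        simp only [Finset.mem_erase, Finset.mem_univ, and_true] at hb
        refine ⟨σ.symm b, ?_, by simp⟩
        simp only [Finset.mem_erase, Finset.mem_univ, and_true]
        intro h; apply hb; rw [← e0, ← h]; simp
      · intro a _; rfl
    have e2 : (∏ i : Fin (m + 1), lgEv (g (i + 1)) (y (σ i))) =
        ∏ i : Fin (m + 1), lgEv (g (σ i + 1)) (y i) := by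
      rw [← Equiv.prod_comp σ (fun i => lgEv (g (σ i + 1)) (y i))]
      simp [hσ]
    have e3 : ∀ i : Fin m, (σ i.succ : ℕ) + 1 = Equiv.swap 1 ((j : ℕ) + 1) (i + 2) := by
      intro i
      rw [hσ, Equiv.swap_apply_def, Equiv.swap_apply_def]
      simp only [Fin.ext_iff, Fin.val_succ, Fin.val_zero]
      split_ifs <;> simp_all <;> omega
    have e4 : lgP y = (∏ l : Fin m, (SignType.sign (y l.succ - y 0) : ℝ)) * lgP (Fin.tail y) := by
      conv_lhs => rw [← Fin.cons_self_tail y]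
      rw [lgP_cons]; rfl
    have e5 : (∏ l : Fin m, (SignType.sign (y l.succ - y 0) : ℝ)) *
        (∏ l : Fin m, (SignType.sign (y l.succ - y 0) : ℝ)) = 1 := by
      rw [← Finset.prod_mul_distrib]
      refine Finset.prod_eq_one fun l _ => ?_
      have : y l.succ ≠ y 0 := fun h => absurd (hy h) (Fin.succ_ne_zero l)
      rcases lt_or_gt_of_ne this with h | h
      · rw [sign_neg (by linarith)]; simp
      · rw [sign_pos (by linarith)]; simp
    rw [e1, e2, lgP_perm, hs, e4, e0, Fin.prod_univ_succ]
    have e6 : (σ 0 : ℕ) = j := by simp [hσ]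
    simp only [e3, e6]
    simp only [Fin.tail]
    linear_combination ((if (j : ℕ) = 0 then (1 : ℝ) else -1) * ((lgEv f (y 0) * lgEv (g (j + 1)) (y 0)) *
        ((∏ i : Fin m, lgEv (g (Equiv.swap 1 ((j : ℕ) + 1) (i + 2))) (y i.succ)) *
          lgP (Fin.tail y)))) * e5
  rw [integral_congr_ae key, integral_const_mul, lg_split]
  congr 1
  simp only [Fin.cons_zero, Fin.tail_cons]
  rw [Measure.volume_eq_prod]
  exact integral_prod_mul (μ := volume) (ν := volume) (fun t => lgEv f t * lgEv (g (j + 1)) t)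
    (fun y : Fin m → ℝ => (∏ i : Fin m, lgEv (g (Equiv.swap 1 ((j : ℕ) + 1) (i + 2))) (y i)) * lgP y)

theorem lgM (m : ℕ) (f : ℝ[X]) (g : ℕ → ℝ[X]) (h0 : g 0 = lgD f) :
    lgL (m + 2) g = 2 * ∑ j ∈ Finset.range (m + 1), (if j = 0 then (1 : ℝ) else -1) *
      (lgG f (g (j + 1)) * lgL m (fun i => g (Equiv.swap 1 (j + 1) (i + 2)))) := by
  rw [Finset.sum_range]
  simp only [← lgMj]
  rw [← integral_finsetSum, ← integral_const_mul]
  · conv_lhs => unfold lgL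
    rw [lg_split' _ (lgL_int _ _ (fun i => lgEv_int _) lgP_meas lgP_le)]
    refine integral_congr_ae ?_
    filter_upwards [lg_ae_inj (m + 1)] with y hy
    have : ∀ t, (∏ i : Fin (m + 2), lgEv (g i) ((Fin.cons t y : Fin (m + 2) → ℝ) i)) *
        lgP (Fin.cons t y : Fin (m + 2) → ℝ) =
        (lgEv (lgD f) t * ∏ l, (SignType.sign (y l - t) : ℝ)) *
        ((∏ i : Fin (m + 1), lgEv (g (i + 1)) (y i)) * lgP y) := by
      intro t
      rw [lgP_cons, Fin.prod_univ_succ]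
      simp only [Fin.cons_zero, Fin.cons_succ, Fin.val_zero, Fin.val_succ, h0]
      ring
    simp only [this]
    rw [integral_mul_const, lg_1d' f y hy, mul_assoc, Finset.sum_mul]
  · intro j _
    have := lgL_int (m + 1) (fun i t => if i = j then lgEv f t * lgEv (g (i + 1)) t else lgEv (g (i + 1)) t)
      (fun i => by
        by_cases h : i = j
        · simp only [h, if_true]; exact lgEv_int2 _ _
        · simp only [h, if_false]; exact lgEv_int _)
      (w := fun y => (∏ l ∈ Finset.univ.erase j, (SignType.sign (y l - y j) : ℝ)) * lgP y)
      ((Finset.measurable_prod _ fun l _ =>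
        lg_sgn_meas.comp ((measurable_pi_apply l).sub (measurable_pi_apply j))).mul lgP_meas)
      (fun y => by
        rw [norm_mul]
        exact mul_le_one₀ (lg_prod_sgn_le _ _) (norm_nonneg _) (lgP_le _))
    refine this.congr (Filter.Eventually.of_forall fun y => ?_)
    simp only
    have e : (∏ i : Fin (m + 1), if i = j then lgEv f (y i) * lgEv (g (i + 1)) (y i)
        else lgEv (g (i + 1)) (y i)) = lgEv f (y j) * ∏ i : Fin (m + 1), lgEv (g (i + 1)) (y i) := by
      rw [← Finset.mul_prod_erase _ _ (Finset.mem_univ j),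
        ← Finset.mul_prod_erase _ (fun i : Fin (m + 1) => lgEv (g (i + 1)) (y i)) (Finset.mem_univ j)]
      rw [if_pos rfl, mul_assoc]
      congr 2
      refine Finset.prod_congr rfl fun i hi => ?_
      rw [if_neg (Finset.ne_of_mem_erase hi)]
    rw [e]; ring

theorem lgG_comm (p q : ℝ[X]) : lgG p q = lgG q p := by
  unfold lgG; congr 1; ext x; ring

theorem lgG_X (p q : ℝ[X]) : lgG (lgX p) q = lgG (lgX q) p := by
  unfold lgG; congr 1; ext x; simp [lgEv, lgX]; ring

/-! ### algebra -/

theorem lgExt_swap {N : ℕ} (s : Equiv.Perm (Fin N)) (a b : Fin N) :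
    lgExt (s * Equiv.swap a b) = lgExt s ∘ Equiv.swap (a : ℕ) b := by
  ext i
  simp only [lgExt, Function.comp]
  by_cases h : i < N
  · have h2 : Equiv.swap (a : ℕ) b i < N := by
      rw [Equiv.swap_apply_def]; split_ifs <;> omega
    rw [dif_pos h, dif_pos h2]
    congr 1
    simp only [Equiv.Perm.mul_apply]
    congr 1
    ext
    simp only [Equiv.swap_apply_def, Fin.ext_iff]
    split_ifs <;> rfl
  · have h1 : i ≠ a := by have := a.2; omega
    have h2 : i ≠ b := by have := b.2; omega
    rw [Equiv.swap_apply_of_ne_of_ne h1 h2, dif_neg h, dif_neg h]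

theorem lgS_swap (N : ℕ) (L : (ℕ → ℝ[X]) → ℝ) (a b : ℕ) (ha : a < N) (hb : b < N) (hab : a ≠ b) :
    lgS N (fun v => L (fun i => v (Equiv.swap a b i))) = - lgS N L := by
  unfold lgS
  rw [← Finset.sum_neg_distrib]
  refine Fintype.sum_equiv (Equiv.mulRight (Equiv.swap ⟨a, ha⟩ ⟨b, hb⟩)) _ _ fun s => ?_
  simp only [Equiv.coe_mulRight, lgExt_swap]
  rw [Equiv.Perm.sign_mul, Equiv.Perm.sign_swap (by simpa using hab)]
  simp

theorem lgS_zero (N : ℕ) (L : (ℕ → ℝ[X]) → ℝ) (a b : ℕ) (ha : a < N) (hb : b < N) (hab : a ≠ b)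
    (h : ∀ v, L (fun i => v (Equiv.swap a b i)) = L v) : lgS N L = 0 := by
  have := lgS_swap N L a b ha hb hab
  simp only [h] at this
  have h2 : lgS N (fun v => L v) = lgS N L := rfl
  linarith

theorem lgS_mul (N : ℕ) (c : ℝ) (L : (ℕ → ℝ[X]) → ℝ) : lgS N (fun v => c * L v) = c * lgS N L := by
  unfold lgS; rw [Finset.mul_sum]; exact Finset.sum_congr rfl fun _ _ => by ring

theorem lgS_neg (N : ℕ) (L : (ℕ → ℝ[X]) → ℝ) : lgS N (fun v => - L v) = - lgS N L := by
  unfold lgS; rw [← Finset.sum_neg_distrib]; exact Finset.sum_congr rfl fun _ _ => by ring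

theorem lgS_add (N : ℕ) (L L' : (ℕ → ℝ[X]) → ℝ) : lgS N (fun v => L v + L' v) = lgS N L + lgS N L' := by
  unfold lgS; rw [← Finset.sum_add_distrib]; exact Finset.sum_congr rfl fun _ _ => by ring

theorem lgS_sum (N : ℕ) {ι : Type*} (s : Finset ι) (L : ι → (ℕ → ℝ[X]) → ℝ) :
    lgS N (fun v => ∑ j ∈ s, L j v) = ∑ j ∈ s, lgS N (L j) := by
  unfold lgS; rw [Finset.sum_comm]; exact Finset.sum_congr rfl fun _ _ => by rw [Finset.mul_sum]

/-- `C` only depends on slots below `a` -/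
def lgDep (a : ℕ) (C : (ℕ → ℝ[X]) → ℝ) : Prop := ∀ v v', (∀ i < a, v i = v' i) → C v = C v'

theorem lgSM (N a m : ℕ) (hN : a + m + 2 ≤ N) (C : (ℕ → ℝ[X]) → ℝ) (hC : lgDep a C)
    (O : ℕ → ℝ[X] → ℝ[X]) (U : ℝ[X] → ℝ[X]) (hU : ∀ p, O 0 p = lgD (U p)) :
    lgS N (fun v => C v * lgL (m + 2) (fun i => O i (v (a + i)))) =
      2 * ∑ j ∈ Finset.range (m + 1), lgS N (fun v => (C v * lgG (U (v a)) (O (j + 1) (v (a + 1)))) *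
        lgL m (fun i => O (Equiv.swap 1 (j + 1) (i + 2)) (v (a + 2 + i)))) := by
  have h1 : ∀ v : ℕ → ℝ[X], lgL (m + 2) (fun i => O i (v (a + i))) = _ := fun v =>
    lgM m (U (v a)) (fun i => O i (v (a + i))) (hU _)
  simp only [h1]
  simp only [← mul_assoc, mul_comm _ (2 : ℝ)]
  simp only [mul_assoc]
  rw [lgS_mul]
  congr 1
  simp only [Finset.mul_sum]
  rw [lgS_sum]
  refine Finset.sum_congr rfl fun j hj => ?_
  rw [Finset.mem_range] at hj
  rcases Nat.eq_zero_or_pos j with rfl | hj0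
  · simp only [if_true, zero_add, Equiv.swap_self, Equiv.refl_apply, one_mul]
    congr 1; ext v
    congr 3
    ext i : 1
    rw [show a + (i + 2) = a + 2 + i by ring]
  · have hs := lgS_swap N (fun v => (C v * lgG (U (v a)) (O (j + 1) (v (a + 1)))) *
        lgL m (fun i => O (Equiv.swap 1 (j + 1) (i + 2)) (v (a + 2 + i)))) (a + 1) (a + (j + 1))
        (by omega) (by omega) (by omega)
    rw [← neg_eq_iff_eq_neg] at hs
    simp only [mul_assoc] at hs
    rw [← hs, ← lgS_neg]
    congr 1; ext v
    rw [if_neg (by omega)]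
    have e1 : C (fun i => v (Equiv.swap (a + 1) (a + (j + 1)) i)) = C v := by
      apply hC
      intro i hi
      rw [Equiv.swap_apply_of_ne_of_ne] <;> omega
    have e2 : Equiv.swap (a + 1) (a + (j + 1)) a = a := by
      rw [Equiv.swap_apply_of_ne_of_ne] <;> omega
    have e3 : ∀ i, Equiv.swap (a + 1) (a + (j + 1)) (a + 2 + i) = a + Equiv.swap 1 (j + 1) (i + 2) := by
      intro i
      simp only [Equiv.swap_apply_def]
      split_ifs <;> omega
    simp only [e1, e2, e3, Equiv.swap_apply_left]
    ring

theorem lgS_symm (N a : ℕ) (hN : a + 2 ≤ N) (C : (ℕ → ℝ[X]) → ℝ) (hC : lgDep a C)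
    (U U' : ℝ[X] → ℝ[X]) (hU : ∀ p q, lgG (U p) (U' q) = lgG (U q) (U' p))
    (R : (ℕ → ℝ[X]) → ℝ) (hR : ∀ v v' : ℕ → ℝ[X], (∀ i, a + 2 ≤ i → v i = v' i) → R v = R v') :
    lgS N (fun v => (C v * lgG (U (v a)) (U' (v (a + 1)))) * R v) = 0 := by
  apply lgS_zero N _ a (a + 1) (by omega) (by omega) (by omega)
  intro v
  have e1 : C (fun i => v (Equiv.swap a (a + 1) i)) = C v := by
      apply hC
      intro i hi
      rw [Equiv.swap_apply_of_ne_of_ne] <;> omega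
  have e2 : R (fun i => v (Equiv.swap a (a + 1) i)) = R v := by
      apply hR
      intro i hi
      rw [Equiv.swap_apply_of_ne_of_ne] <;> omega
  simp only [e1, e2, Equiv.swap_apply_left, Equiv.swap_apply_right]
  rw [hU]

theorem lgDep_mul (a : ℕ) (C : (ℕ → ℝ[X]) → ℝ) (hC : lgDep a C) (U U' : ℝ[X] → ℝ[X]) :
    lgDep (a + 2) (fun v => C v * lgG (U (v a)) (U' (v (a + 1)))) := by
  intro v v' h
  simp only
  rw [hC v v' fun i hi => h i (by omega), h a (by omega), h (a + 1) (by omega)]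

def lgO (r : ℕ) (T : ℝ[X] → ℝ[X]) (i : ℕ) : ℝ[X] → ℝ[X] :=
  if i < r then lgD else if i = r then T else id

theorem lg_odd (N q : ℕ) : ∀ (a m : ℕ) (_ : a + m ≤ N) (_ : 2 * q + 1 ≤ m)
    (C : (ℕ → ℝ[X]) → ℝ) (_ : lgDep a C),
    lgS N (fun v => C v * lgL m (fun i => lgO (2 * q + 1) id i (v (a + i)))) = 0 := by
  induction q with
  | zero =>
    intro a m hN hm C hC
    rcases m with _ | _ | m
    · omega
    · have : ∀ v : ℕ → ℝ[X], lgL (0 + 1) (fun i => lgO (2 * 0 + 1) id i (v (a + i))) = 0 :=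
        fun v => lgM1 (v a) _ (by simp [lgO])
      unfold lgS
      refine Finset.sum_eq_zero fun s _ => ?_
      beta_reduce
      rw [this (fun i => lgH (lgExt s i)), mul_zero, mul_zero]
    · rw [lgSM N a m (by omega) C hC _ id (by simp [lgO])]
      rw [Finset.sum_eq_zero, mul_zero]
      intro j hj
      have : lgO (2 * 0 + 1) id (j + 1) = id := by simp [lgO]
      rw [this]
      refine lgS_symm N a (by omega) C hC id id (fun p q => lgG_comm _ _) _ ?_
      intro v v' h
      apply lgL_congr
      intro i hi
      rw [h _ (by omega)]
  | succ q ih =>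
    intro a m hN hm C hC
    obtain ⟨m, rfl⟩ : ∃ m', m = m' + 2 := ⟨m - 2, by omega⟩
    rw [lgSM N a m (by omega) C hC _ id (by simp [lgO])]
    rw [Finset.sum_eq_zero, mul_zero]
    intro j hj
    by_cases hjr : j + 1 < 2 * (q + 1) + 1
    · have : ∀ i, lgO (2 * (q + 1) + 1) id (Equiv.swap 1 (j + 1) (i + 2)) = lgO (2 * q + 1) id i := by
        intro i
        simp only [lgO, Equiv.swap_apply_def]
        split_ifs <;> first | rfl | omega
      simp only [this]
      exact ih (a + 2) m (by omega) (by omega) _ (lgDep_mul a C hC id _)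
    · have : lgO (2 * (q + 1) + 1) id (j + 1) = id := by simp [lgO, hjr]
      rw [this]
      refine lgS_symm N a (by omega) C hC id id (fun p q => lgG_comm _ _) _ ?_
      intro v v' h
      apply lgL_congr
      intro i hi
      rw [h _ (by omega)]

theorem lg_even (N q a m : ℕ) (hN : a + m ≤ N) (hm : 2 * q + 3 ≤ m)
    (C : (ℕ → ℝ[X]) → ℝ) (hC : lgDep a C) (T : ℝ[X] → ℝ[X]) :
    lgS N (fun v => C v * lgL m (fun i => lgO (2 * q + 2) T i (v (a + i)))) =
      2 * (2 * q + 1) * lgS N (fun v => (C v * lgG (v a) (lgD (v (a + 1)))) *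
        lgL (m - 2) (fun i => lgO (2 * q) T i (v (a + 2 + i)))) := by
  obtain ⟨m, rfl⟩ : ∃ m', m = m' + 2 := ⟨m - 2, by omega⟩
  rw [lgSM N a m (by omega) C hC _ id (by simp [lgO])]
  rw [Nat.add_sub_cancel, mul_assoc]
  congr 1
  rw [← Finset.sum_subset (s₁ := Finset.range (2 * q + 1)) (by
    intro x; simp only [Finset.mem_range]; omega)]
  · rw [Finset.sum_congr rfl (g := fun _ => lgS N (fun v => (C v * lgG (v a) (lgD (v (a + 1)))) *
        lgL m (fun i => lgO (2 * q) T i (v (a + 2 + i)))))]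
    · simp
    · intro j hj
      rw [Finset.mem_range] at hj
      have : ∀ i, lgO (2 * q + 2) T (Equiv.swap 1 (j + 1) (i + 2)) = lgO (2 * q) T i := by
        intro i
        simp only [lgO, Equiv.swap_apply_def]
        split_ifs <;> first | rfl | omega
      have h2 : lgO (2 * q + 2) T (j + 1) = lgD := by
        simp only [lgO]; rw [if_pos (by omega)]
      simp only [this, h2, id]
  · intro j hj hj'
    simp only [Finset.mem_range] at hj hj'
    by_cases hj2 : j = 2 * q + 1
    · have : ∀ i, lgO (2 * q + 2) T (Equiv.swap 1 (j + 1) (i + 2)) = lgO (2 * q + 1) id i := by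
        intro i
        simp only [lgO, Equiv.swap_apply_def]
        split_ifs <;> first | rfl | omega
      simp only [this]
      exact lg_odd N q (a + 2) m (by omega) (by omega) _ (lgDep_mul a C hC id _)
    · have : lgO (2 * q + 2) T (j + 1) = id := by
        simp only [lgO]; rw [if_neg (by omega), if_neg (by omega)]
      rw [this]
      refine lgS_symm N a (by omega) C hC id id (fun p q => lgG_comm _ _) _ ?_
      intro v v' h
      apply lgL_congr
      intro i hi
      rw [h _ (by omega)]

def lgC (k : ℕ) (v : ℕ → ℝ[X]) : ℝ := ∏ l ∈ Finset.range k, lgG (v (2 * l)) (lgD (v (2 * l + 1)))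

theorem lgC_dep (k : ℕ) : lgDep (2 * k) (lgC k) := by
  intro v v' h
  refine Finset.prod_congr rfl fun l hl => ?_
  rw [Finset.mem_range] at hl
  rw [h _ (by omega), h _ (by omega)]

def lgK (N k : ℕ) (T : ℝ[X] → ℝ[X]) : ℝ :=
  lgS N (fun v => lgC k v * lgL (N - 2 * k) (fun i => lgO 0 T i (v (2 * k + i))))

theorem lg_unmerge (N q : ℕ) : ∃ c : ℝ, c ≠ 0 ∧ ∀ k T, 2 * k + 2 * q + 1 ≤ N →
    lgS N (fun v => lgC k v * lgL (N - 2 * k) (fun i => lgO (2 * q) T i (v (2 * k + i)))) =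
      c * lgK N (k + q) T := by
  induction q with
  | zero => exact ⟨1, one_ne_zero, fun k T _ => by simp [lgK]⟩
  | succ q ih =>
    obtain ⟨c, hc, h⟩ := ih
    refine ⟨2 * (2 * q + 1) * c, mul_ne_zero (by positivity) hc, fun k T hk => ?_⟩
    have := lg_even N q (2 * k) (N - 2 * k) (by omega) (by omega) (lgC k) (lgC_dep k) T
    rw [show 2 * (q + 1) = 2 * q + 2 by ring, this, mul_assoc, mul_assoc, mul_assoc]
    congr 2
    have h' := h (k + 1) T (by omega)
    rw [show k + (q + 1) = k + 1 + q by ring, ← h']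
    congr 1
    ext v
    rw [lgC, lgC, Finset.prod_range_succ, Nat.sub_sub]
    rfl

theorem lgN_eq (p : ℝ[X]) : lgD (lgX p) + lgN p = -1 • lgD (lgD p) := by
  simp only [lgD, lgX, lgN]
  simp
  ring

theorem lgK_N (N k : ℕ) (h : 2 * k + 2 ≤ N) :
    lgK N k lgN = 2 * ((N - 2 * k : ℕ) - 1) * lgK N (k + 1) id := by
  obtain ⟨m, hm⟩ : ∃ m, N - 2 * k = m + 2 := ⟨N - 2 * k - 2, by omega⟩
  have hX : lgK N k (fun p => lgD (lgX p)) = 0 := by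
    unfold lgK
    rw [hm, lgSM N (2 * k) m (by omega) _ (lgC_dep k) _ lgX (by simp [lgO])]
    rw [Finset.sum_eq_zero, mul_zero]
    intro j hj
    have : lgO 0 (fun p => lgD (lgX p)) (j + 1) = id := by simp [lgO]
    rw [this]
    refine lgS_symm N (2 * k) (by omega) _ (lgC_dep k) lgX id (fun p q => lgG_X _ _) _ ?_
    intro v v' h
    apply lgL_congr
    intro i hi
    rw [h _ (by omega)]
  have hD : lgK N k (fun p => lgD (lgD p)) = - (2 * ((N - 2 * k : ℕ) - 1) * lgK N (k + 1) id) := by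
    unfold lgK
    rw [hm, lgSM N (2 * k) m (by omega) _ (lgC_dep k) _ lgD (by simp [lgO])]
    rw [mul_assoc, ← mul_neg]
    congr 1
    have hh : ((m + 2 : ℕ) : ℝ) - 1 = (m + 1 : ℕ) := by push_cast; ring
    rw [hh, Finset.sum_congr rfl (g := fun _ => - lgS N fun v =>
        lgC (k + 1) v * lgL (N - 2 * (k + 1)) fun i => lgO 0 id i (v (2 * (k + 1) + i)))]
    · simp
    intro j hj
    rw [← neg_one_mul, ← lgS_mul]
    congr 1
    ext v
    have e1 : ∀ i, lgO 0 (fun p => lgD (lgD p)) (Equiv.swap 1 (j + 1) (i + 2)) = lgO 0 id i := by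
        intro i
        have h1 : Equiv.swap 1 (j + 1) (i + 2) ≠ 0 := by
          rw [Equiv.swap_apply_def]; split_ifs <;> omega
        simp [lgO, h1]
    have e2 : lgO 0 (fun p => lgD (lgD p)) (j + 1) = id := by simp [lgO]
    simp only [e1, e2]
    rw [lgG_D, show N - 2 * (k + 1) = m by omega]
    simp only [lgC, Finset.prod_range_succ, id, show 2 * (k + 1) = 2 * k + 2 by ring]
    ring
  have hsum : lgK N k (fun p => lgD (lgX p)) + lgK N k lgN = - lgK N k (fun p => lgD (lgD p)) := by
    unfold lgK
    rw [← lgS_add, ← neg_one_mul, ← lgS_mul]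
    congr 1; ext v
    rw [← mul_add, mul_left_comm, hm]
    congr 1
    rw [← lgL_add (m + 1) (fun i => lgO 0 (fun p => lgD (lgX p) + lgN p) i (v (2 * k + i)))]
    · have := lgL_smul (m + 2) (fun i => if i = 0 then -1 else 1)
        (fun i => lgO 0 (fun p => lgD (lgD p)) i (v (2 * k + i)))
      simp only [Finset.prod_ite_eq', Finset.mem_range] at this
      rw [if_pos (by omega)] at this
      rw [← this]
      apply lgL_congr
      intro i hi
      by_cases hi0 : i = 0
      · subst hi0
        simp [lgO]
        simpa using lgN_eq (v (2 * k))
      · simp [lgO, hi0]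
    · simp [lgO]
    · intro i hi; simp [lgO, hi.ne']
    · intro i hi; simp [lgO, hi.ne']
  rw [hX, hD] at hsum
  linarith

/-! Hermite -/
theorem lgD_H (i : ℕ) : lgD (lgH i) = (-1 : ℝ) • lgH (i + 1) := by
  simp [lgD, lgH, hermite_succ]

theorem lgN_D (p : ℝ[X]) : lgN (lgD p) = lgD (lgN p) + lgD p := by
  simp only [lgN, lgD]
  simp
  ring

theorem lgN_H (i : ℕ) : lgN (lgH i) = (i : ℝ) • lgH i := by
  induction i with
  | zero => simp [lgN, lgH]
  | succ i ih =>
    have h1 : lgH (i + 1) = (-1 : ℝ) • lgD (lgH i) := by rw [lgD_H]; simp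
    have hs : ∀ (c : ℝ) p, lgN (c • p) = c • lgN p := by
      intro c p; simp [lgN, smul_sub]
    have hs' : ∀ (c : ℝ) p, lgD (c • p) = c • lgD p := by
      intro c p; simp [lgD, smul_sub]
    rw [h1, hs, lgN_D, ih, hs']
    push_cast
    module

theorem lg_repeat (m : ℕ) (a b : ℕ) (ha : a < m) (hb : b < m) (hab : a ≠ b) (g : ℕ → ℝ[X])
    (h : g a = g b) : lgL m g = 0 := by
  have := lgL_swap m a b ha hb hab g
  have e : (fun i => g (Equiv.swap a b i)) = g := by
    ext i : 1
    rw [Equiv.swap_apply_def]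
    split_ifs with h1 h2
    · rw [h1, h]
    · rw [h2, h]
    · rfl
  rw [e] at this
  linarith

theorem lg_down (A : Finset ℕ) (h : ∀ x, x + 1 ∈ A → x ∈ A) : A = Finset.range A.card := by
  have h2 : ∀ d x, x + d ∈ A → x ∈ A := by
    intro d
    induction d with
    | zero => intro x hx; exact hx
    | succ d ih => intro x hx; exact ih x (h _ hx)
  apply Finset.eq_of_subset_of_card_le
  · intro x hx
    rw [Finset.mem_range]
    have : Finset.range (x + 1) ⊆ A := by
      intro y hy
      rw [Finset.mem_range] at hy
      exact h2 (x - y) y (by rw [show y + (x - y) = x by omega]; exact hx)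
    have := Finset.card_le_card this
    rw [Finset.card_range] at this
    omega
  · simp

theorem lgExt_inj {N : ℕ} (s : Equiv.Perm (Fin N)) (i j : ℕ) (hi : i < N) (hj : j < N)
    (h : lgExt s i = lgExt s j) : i = j := by
  simp only [lgExt, dif_pos hi, dif_pos hj] at h
  have := s.injective (Fin.ext h)
  simpa using this

theorem lgExt_lt {N : ℕ} (s : Equiv.Perm (Fin N)) (i : ℕ) (hi : i < N) : lgExt s i < N := by
  simp only [lgExt, dif_pos hi]; exact (s _).2

theorem lgExt_surj {N : ℕ} (s : Equiv.Perm (Fin N)) (x : ℕ) (hx : x < N) :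
    ∃ i < N, lgExt s i = x := by
  refine ⟨s.symm ⟨x, hx⟩, (s.symm ⟨x, hx⟩).2, ?_⟩
  simp [lgExt]

theorem lg_supp (N r : ℕ) (s : Equiv.Perm (Fin N))
    (h : lgL N (fun i => lgO r id i (lgH (lgExt s i))) ≠ 0) :
    ∑ j ∈ Finset.Ico r N, lgExt s j = ∑ x ∈ Finset.range (N - r), x := by
  set A := (Finset.Ico r N).image (lgExt s) with hA
  have hinj : Set.InjOn (lgExt s) (Finset.Ico r N) := by
    intro i hi j hj hij
    simp only [Finset.coe_Ico, Set.mem_Ico] at hi hj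
    exact lgExt_inj s i j hi.2 hj.2 hij
  have hcard : A.card = N - r := by
    rw [hA, Finset.card_image_of_injOn hinj, Nat.card_Ico]
  have hd : ∀ x, x + 1 ∈ A → x ∈ A := by
    intro x hx
    by_contra hxA
    rw [hA, Finset.mem_image] at hx
    obtain ⟨j, hj, hjx⟩ := hx
    rw [Finset.mem_Ico] at hj
    have hlt := lgExt_lt s j hj.2
    obtain ⟨i, hi, hix⟩ := lgExt_surj s x (by omega)
    have hir : i < r := by
      by_contra hir
      apply hxA
      rw [hA, Finset.mem_image]
      exact ⟨i, by rw [Finset.mem_Ico]; omega, hix⟩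
    apply h
    have e : (fun i => lgO r id i (lgH (lgExt s i))) = fun i => (if i < r then (-1 : ℝ) else 1) •
        lgH (if i < r then lgExt s i + 1 else lgExt s i) := by
      ext i : 1
      by_cases hi : i < r
      · simp [lgO, hi, lgD_H]
      · simp [lgO, hi]
    rw [e, lgL_smul]
    rw [lg_repeat N i j hi hj.2 (by omega), mul_zero]
    rw [if_pos hir, if_neg (by omega), hix, hjx]
  have := lg_down A hd
  rw [hcard] at this
  rw [← this, hA, Finset.sum_image (fun i hi j hj h => hinj hi hj h)]

theorem lg_number (N r : ℕ) (hr : r + 1 ≤ N) :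
    lgS N (fun v => lgL N (fun i => lgO r lgN i (v i))) =
      ((N - r : ℕ) - 1) / 2 * lgS N (fun v => lgL N (fun i => lgO r id i (v i))) := by
  set f : Equiv.Perm (Fin N) → ℝ := fun s => ((Equiv.Perm.sign s : ℤ) : ℝ) *
    lgL N (fun i => lgO r id i (lgH (lgExt s i))) with hf
  have h1 : lgS N (fun v => lgL N (fun i => lgO r lgN i (v i))) = ∑ s, (lgExt s r : ℝ) * f s := by
    unfold lgS
    refine Finset.sum_congr rfl fun s _ => ?_
    beta_reduce
    have := lgL_smul N (fun i => if i = r then (lgExt s i : ℝ) else 1)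
      (fun i => lgO r id i (lgH (lgExt s i)))
    simp only [Finset.prod_ite_eq', Finset.mem_range] at this
    rw [if_pos (by omega)] at this
    rw [hf]
    beta_reduce
    rw [mul_left_comm, ← this]
    congr 1
    apply lgL_congr
    intro i hi
    by_cases hir : i = r
    · subst hir; simp [lgO, lgN_H]
    · simp [lgO, hir]
  have h2 : lgS N (fun v => lgL N (fun i => lgO r id i (v i))) = ∑ s, f s := rfl
  have h3 : ∀ j ∈ Finset.Ico r N, ∑ s, (lgExt s r : ℝ) * f s = ∑ s, (lgExt s j : ℝ) * f s := by
    intro j hj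
    rw [Finset.mem_Ico] at hj
    by_cases hjr : j = r
    · rw [hjr]
    refine Fintype.sum_equiv (Equiv.mulRight (Equiv.swap ⟨r, by omega⟩ ⟨j, hj.2⟩)) _ _ fun s => ?_
    simp only [Equiv.coe_mulRight, hf, lgExt_swap]
    rw [Equiv.Perm.sign_mul, Equiv.Perm.sign_swap (by simpa using (Ne.symm hjr))]
    simp only [Function.comp, Equiv.swap_apply_right]
    have hsw := lgL_swap N r j (by omega) hj.2 (Ne.symm hjr) (fun i => lgO r id i (lgH (lgExt s i)))
    have e : ∀ i, lgO r id (Equiv.swap r j i) = lgO r id i := by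
      intro i
      rw [Equiv.swap_apply_def]
      split_ifs with h1 h2
      · subst h1; simp [lgO, hj.1]
      · subst h2; simp [lgO, hj.1]
      · rfl
    simp only [e] at hsw
    rw [hsw]
    simp
  have h4 : ((N - r : ℕ) : ℝ) * ∑ s, (lgExt s r : ℝ) * f s =
      ((N - r : ℕ) * ((N - r : ℕ) - 1) / 2) * ∑ s, f s := by
    have : ∑ j ∈ Finset.Ico r N, ∑ s, (lgExt s r : ℝ) * f s =
      ∑ j ∈ Finset.Ico r N, ∑ s, (lgExt s j : ℝ) * f s := Finset.sum_congr rfl h3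
    rw [Finset.sum_const, Nat.card_Ico, nsmul_eq_mul] at this
    rw [this, Finset.sum_comm, Finset.mul_sum]
    refine Finset.sum_congr rfl fun s _ => ?_
    rw [← Finset.sum_mul]
    by_cases h0 : lgL N (fun i => lgO r id i (lgH (lgExt s i))) = 0
    · simp [hf, h0]
    · have hs := lg_supp N r s h0
      congr 1
      rw [← Nat.cast_sum, hs]
      have := Finset.sum_range_id_mul_two (N - r)
      have h5 : ((∑ x ∈ Finset.range (N - r), x : ℕ) : ℝ) * 2 = (N - r : ℕ) * ((N - r : ℕ) - 1) := by
        rw [← Nat.cast_two, ← Nat.cast_mul, this, Nat.cast_mul, Nat.cast_sub (n := N - r) (by omega)]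
        simp
      linarith
  rw [h1, h2]
  have h6 : ((N - r : ℕ) : ℝ) ≠ 0 := by
    rw [Nat.cast_ne_zero]; omega
  apply mul_left_cancel₀ h6
  rw [h4]; ring

theorem lgK_step (N k : ℕ) (h : 2 * k + 2 ≤ N) : lgK N (k + 1) id = lgK N k id / 4 := by
  obtain ⟨c, hc, hu⟩ := lg_unmerge N k
  have h1 := hu 0 lgN (by omega)
  have h2 := hu 0 id (by omega)
  simp only [lgC, Finset.range_zero, Finset.prod_empty, one_mul, mul_zero, Nat.sub_zero, zero_add] at h1 h2
  rw [lg_number N (2 * k) (by omega), h2, lgK_N N k h] at h1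
  have h7 : (((N - 2 * k : ℕ) : ℝ) - 1) ≠ 0 := by
    have : (2 : ℝ) ≤ ((N - 2 * k : ℕ) : ℝ) := by
      exact_mod_cast (by omega : 2 ≤ N - 2 * k)
    linarith
  apply mul_left_cancel₀ hc
  apply mul_left_cancel₀ h7
  linarith

theorem lgK_main (N k : ℕ) (h : 2 * k ≤ N) : lgK N k id = (1 / 4) ^ k * lgK N 0 id := by
  induction k with
  | zero => simp
  | succ k ih => rw [lgK_step N k (by omega), ih (by omega), pow_succ]; ring


def lgW (x : ℝ) : ℝ := Real.exp (-x ^ 2 / 2)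

def lgCol (k : ℕ) (y x : ℕ → ℝ) (j : ℕ) (p : ℝ[X]) : ℝ :=
  if j < 2 * k then (if j % 2 = 0 then lgEv p (y (j / 2)) else lgEv (lgD p) (y (j / 2)))
  else lgEv p (x (j - 2 * k))

def lgR (k m : ℕ) (y x : ℕ → ℝ) : ℝ :=
  (∏ l ∈ Finset.range k, ∏ l' ∈ Finset.range l, (y l - y l') ^ 4) *
  (∏ l ∈ Finset.range k, ∏ i ∈ Finset.range m, (x i - y l) ^ 2) *
  (∏ i ∈ Finset.range m, ∏ i' ∈ Finset.range i, (x i - x i')) *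
  (∏ i ∈ Finset.range m, lgW (x i)) * (∏ l ∈ Finset.range k, lgW (y l) ^ 2)

def lgMat (N k : ℕ) (y x : ℕ → ℝ) : Matrix (Fin N) (Fin N) ℝ :=
  Matrix.of fun a j => lgCol k y x j (lgH a)

theorem lg_prod_Ioi (m : ℕ) (f : ℕ → ℕ → ℝ) :
    ∏ i : Fin m, ∏ j ∈ Finset.Ioi i, f i j = ∏ j ∈ Finset.range m, ∏ i ∈ Finset.range j, f i j := by
  rw [Finset.prod_comm' (t' := Finset.univ) (s' := fun j => Finset.Iio j) (by simp), Finset.prod_range]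
  refine Finset.prod_congr rfl fun j _ => ?_
  rw [← Nat.Iio_eq_range, ← Fin.map_valEmbedding_Iio, Finset.prod_map]
  rfl

theorem lgMat_zero (m : ℕ) (y x : ℕ → ℝ) : (lgMat m 0 y x).det = lgR 0 m y x := by
  have e : lgMat m 0 y x = Matrix.of fun a j => (fun j : Fin m => lgW (x j)) j *
      ((Matrix.of (fun i j : Fin m => (lgH j).eval (x i))).transpose a j) := by
    ext a j
    simp [lgMat, lgCol, lgEv, lgW, mul_comm]
  rw [e, Matrix.det_mul_row, Matrix.det_transpose,
    ← Matrix.det_eval_matrixOfPolynomials_eq_det_vandermonde (fun i : Fin m => x i) (fun j => lgH j),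
    Matrix.det_vandermonde, lg_prod_Ioi m (fun i j => x j - x i)]
  · simp [lgR, Finset.prod_range, mul_comm]
  · intro i
    rw [lgH, (hermite_monic _).natDegree_map, natDegree_hermite]
  · intro i
    exact (hermite_monic _).map _

theorem lg_slope (R : ℝ → ℝ) (s : ℝ) (hR : ContinuousAt R s) :
    HasDerivAt (fun t => (t - s) * R t) (R s) s := by
  rw [hasDerivAt_iff_tendsto_slope]
  refine (hR.tendsto.mono_left nhdsWithin_le_nhds).congr' ?_
  filter_upwards [self_mem_nhdsWithin] with t ht
  have : t - s ≠ 0 := sub_ne_zero.2 ht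
  simp [slope, this]

theorem lgMat_det (k : ℕ) : ∀ (m : ℕ) (y x : ℕ → ℝ), (lgMat (m + 2 * k) k y x).det = lgR k m y x := by
  induction k with
  | zero => intro m y x; exact lgMat_zero m y x
  | succ k ih =>
    intro m y x
    have hN : m + 2 * (k + 1) = m + 2 + 2 * k := by ring
    rw [hN]
    set s := y k with hs
    let X' : ℝ → ℕ → ℝ := fun t i => if i = 0 then s else if i = 1 then t else x (i - 2)
    let j0 : Fin (m + 2 + 2 * k) := ⟨2 * k + 1, by omega⟩
    set A := lgMat (m + 2 + 2 * k) k y (X' s) with hA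
    have h1 : ∀ t, (A.updateCol j0 (fun a => lgEv (lgH a) t)).det = lgR k (m + 2) y (X' t) := by
      intro t
      rw [← ih (m + 2) y (X' t)]
      congr 1
      ext a j
      rw [Matrix.updateCol_apply]
      split_ifs with hj
      · subst hj
        simp [lgMat, lgCol, j0, X']
      · have hj' : (j : ℕ) ≠ 2 * k + 1 := fun h => hj (Fin.ext h)
        simp only [hA, lgMat, lgCol, Matrix.of_apply, X']
        by_cases h2 : (j : ℕ) < 2 * k
        · simp [h2]
        · have h3 : (j : ℕ) - 2 * k ≠ 1 := by omega
          simp [h2, h3]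
    have h2 : A.updateCol j0 (fun a => lgEv (lgD (lgH a)) s) = lgMat (m + 2 + 2 * k) (k + 1) y x := by
      ext a j
      rw [Matrix.updateCol_apply]
      split_ifs with hj
      · subst hj
        have e1 : (2 * k + 1) / 2 = k := by omega
        have e2 : (2 * k + 1) % 2 = 1 := by omega
        have e3 : 2 * k + 1 < 2 * (k + 1) := by omega
        simp only [lgMat, lgCol, j0, Matrix.of_apply, e1, e2, e3, if_true, ← hs]
        simp
      · have hj' : (j : ℕ) ≠ 2 * k + 1 := fun h => hj (Fin.ext h)
        simp only [hA, lgMat, lgCol, Matrix.of_apply, X']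
        by_cases h2 : (j : ℕ) < 2 * k
        · have h3 : (j : ℕ) < 2 * (k + 1) := by omega
          simp [h2, h3]
        · by_cases h4 : (j : ℕ) = 2 * k
          · have e1 : (2 * k) / 2 = k := by omega
            have e3 : 2 * k < 2 * (k + 1) := by omega
            simp [h4, e3, ← hs]
          · have h3 : (j : ℕ) - 2 * k ≠ 1 := by omega
            have h5 : (j : ℕ) - 2 * k ≠ 0 := by omega
            have h6 : ¬ (j : ℕ) < 2 * (k + 1) := by omega
            have h7 : (j : ℕ) - 2 * k - 2 = j - 2 * (k + 1) := by omega
            rw [if_neg h2, if_neg h5, if_neg h3, if_neg h6, h7]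
    have d1 : HasDerivAt (fun t => (A.updateCol j0 (fun a => lgEv (lgH a) t)).det)
        ((A.updateCol j0 (fun a => lgEv (lgD (lgH a)) s)).det) s := by
      have hF : HasDerivAt (fun t => (fun a : Fin (m + 2 + 2 * k) => lgEv (lgH a) t))
          (fun a => lgEv (lgD (lgH a)) s) s := hasDerivAt_pi.2 fun a => lgEv_deriv _ _
      let L : (Fin (m + 2 + 2 * k) → ℝ) →ₗ[ℝ] ℝ := (LinearMap.proj j0).comp (Matrix.cramer A)
      exact (LinearMap.toContinuousLinearMap L).hasFDerivAt.comp_hasDerivAt s hF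
    let R : ℝ → ℝ := fun t =>
      (∏ l ∈ Finset.range k, ∏ l' ∈ Finset.range l, (y l - y l') ^ 4) *
      (∏ l ∈ Finset.range k, (∏ i ∈ Finset.range m, (x i - y l) ^ 2) * (t - y l) ^ 2 * (s - y l) ^ 2) *
      ((∏ i ∈ Finset.range m, (∏ i' ∈ Finset.range i, (x i - x i')) * (x i - t) * (x i - s))) *
      ((∏ i ∈ Finset.range m, lgW (x i)) * lgW t * lgW s) * (∏ l ∈ Finset.range k, lgW (y l) ^ 2)
    have h3 : ∀ t, lgR k (m + 2) y (X' t) = (t - s) * R t := by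
      intro t
      simp only [lgR, R, X', Finset.prod_range_succ']
      simp
      ring
    have hR : ContinuousAt R s := by
      have hW : Continuous lgW := by unfold lgW; fun_prop
      apply Continuous.continuousAt
      simp only [R]
      fun_prop
    have d2 := lg_slope R s hR
    simp only [h1, h3] at d1
    have := d1.unique d2
    rw [← h2, this]
    simp only [R, lgR, Finset.prod_range_succ, Finset.prod_mul_distrib, Finset.prod_pow, ← hs]
    have e4 : ∏ l ∈ Finset.range k, (s - y l) ^ 4 = (∏ l ∈ Finset.range k, (s - y l)) ^ 4 := Finset.prod_pow _ _ _
    ring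

def lgPad {m : ℕ} (x : Fin m → ℝ) (i : ℕ) : ℝ := if h : i < m then x ⟨i, h⟩ else 0

theorem lgPad_val {m : ℕ} (x : Fin m → ℝ) (i : Fin m) : lgPad x i = x i := by
  simp [lgPad]

theorem lgPad_append_left {m k : ℕ} (x : Fin m → ℝ) (y : Fin k → ℝ) (i : ℕ) (h : i < m) :
    lgPad (Fin.append x y) i = lgPad x i := by
  have h2 : i < m + k := by omega
  simp only [lgPad, h, h2, dif_pos]
  exact Fin.append_left x y ⟨i, h⟩

theorem lgPad_append_right {m k : ℕ} (x : Fin m → ℝ) (y : Fin k → ℝ) (i : ℕ) (h : i < k) :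
    lgPad (Fin.append x y) (m + i) = lgPad y i := by
  have h2 : m + i < m + k := by omega
  simp only [lgPad, h, h2, dif_pos]
  exact Fin.append_right x y ⟨i, h⟩

theorem lg_int_append (m k : ℕ) (F : (Fin (m + k) → ℝ) → ℝ) :
    ∫ z, F z = ∫ p : (Fin m → ℝ) × (Fin k → ℝ), F (Fin.append p.1 p.2) := by
  have h1 := (volume_measurePreserving_piCongrLeft (fun _ : Fin (m + k) => ℝ)
    (finSumFinEquiv (m := m) (n := k))).integral_comp' F
  rw [← h1]
  have h2 := (volume_measurePreserving_sumPiEquivProdPi_symm (fun _ : Fin m ⊕ Fin k => ℝ)).integral_comp'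
    (fun z => F (MeasurableEquiv.piCongrLeft (fun _ : Fin (m + k) => ℝ) finSumFinEquiv z))
  rw [← h2]
  congr 1; ext p; congr 1; ext i
  obtain ⟨j, rfl⟩ := finSumFinEquiv.surjective i
  rw [MeasurableEquiv.coe_piCongrLeft, Equiv.piCongrLeft_apply_apply,
    MeasurableEquiv.coe_sumPiEquivProdPi_symm]
  cases j <;> simp

theorem lg_prod_pairs (N : ℕ) (f : ℕ → ℕ → ℝ) :
    ∏ p ∈ Finset.univ.filter (fun p : Fin N × Fin N => p.1 < p.2), f p.1 p.2 =
      ∏ j ∈ Finset.range N, ∏ i ∈ Finset.range j, f i j := by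
  rw [← lg_prod_Ioi, Finset.prod_filter, Fintype.prod_prod_type]
  refine Finset.prod_congr rfl fun i _ => ?_
  rw [← Finset.prod_filter]
  congr 1
  ext j; simp

theorem lg_integrand (m k : ℕ) (x : Fin m → ℝ) (y : Fin k → ℝ) :
    Real.exp (-∑ i : Fin (m + k), (if (i : ℕ) < m then (1 : ℝ) else 2) * Fin.append x y i ^ 2 / 2) *
      ∏ p ∈ Finset.univ.filter (fun p : Fin (m + k) × Fin (m + k) => p.1 < p.2),
        |Fin.append x y p.1 - Fin.append x y p.2| ^
          ((if (p.1 : ℕ) < m then 1 else 2) * (if (p.2 : ℕ) < m then 1 else 2)) =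
    lgP x * lgR k m (lgPad y) (lgPad x) := by
  set z := Fin.append x y with hz
  have h1 : Real.exp (-∑ i : Fin (m + k), (if (i : ℕ) < m then (1 : ℝ) else 2) * z i ^ 2 / 2) =
      (∏ i ∈ Finset.range m, lgW (lgPad x i)) * (∏ l ∈ Finset.range k, lgW (lgPad y l) ^ 2) := by
    rw [← Finset.sum_neg_distrib, Real.exp_sum]
    simp only [← lgPad_val]
    rw [← Finset.prod_range (fun i => Real.exp (-((if i < m then (1 : ℝ) else 2) * lgPad z i ^ 2 / 2))),
      Finset.prod_range_add]
    congr 1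
    · refine Finset.prod_congr rfl fun i hi => ?_
      rw [Finset.mem_range] at hi
      rw [hz, lgPad_append_left x y i hi, if_pos hi, lgW]
      congr 1; ring
    · refine Finset.prod_congr rfl fun i hi => ?_
      rw [Finset.mem_range] at hi
      rw [hz, lgPad_append_right x y i hi, if_neg (by omega), lgW, ← Real.exp_nat_mul]
      congr 1; push_cast; ring
  have h2 : lgP x * ∏ i ∈ Finset.range m, ∏ i' ∈ Finset.range i, (lgPad x i - lgPad x i') =
      ∏ i ∈ Finset.range m, ∏ i' ∈ Finset.range i, |lgPad x i' - lgPad x i| := by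
    unfold lgP
    simp only [← lgPad_val x]
    rw [lg_prod_Ioi m (fun i j => (SignType.sign (lgPad x j - lgPad x i) : ℝ)), ← Finset.prod_mul_distrib]
    refine Finset.prod_congr rfl fun i _ => ?_
    rw [← Finset.prod_mul_distrib]
    refine Finset.prod_congr rfl fun j _ => ?_
    rw [sign_mul_self, abs_sub_comm]
  have h3 : ∏ p ∈ Finset.univ.filter (fun p : Fin (m + k) × Fin (m + k) => p.1 < p.2),
        |z p.1 - z p.2| ^
          ((if (p.1 : ℕ) < m then 1 else 2) * (if (p.2 : ℕ) < m then 1 else 2)) =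
      (∏ i ∈ Finset.range m, ∏ i' ∈ Finset.range i, |lgPad x i' - lgPad x i|) *
      ((∏ l ∈ Finset.range k, ∏ i ∈ Finset.range m, (lgPad x i - lgPad y l) ^ 2) *
        (∏ l ∈ Finset.range k, ∏ l' ∈ Finset.range l, (lgPad y l - lgPad y l') ^ 4)) := by
    simp only [← lgPad_val z]
    rw [lg_prod_pairs (m + k) (fun i j => |lgPad z i - lgPad z j| ^
          ((if i < m then 1 else 2) * (if j < m then 1 else 2))), Finset.prod_range_add,
        ← Finset.prod_mul_distrib]
    congr 1
    · refine Finset.prod_congr rfl fun i hi => Finset.prod_congr rfl fun j hj => ?_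
      rw [Finset.mem_range] at hi hj
      have hj' : j < m := by omega
      rw [hz, lgPad_append_left x y i hi, lgPad_append_left x y j hj', if_pos hi, if_pos hj']
      simp
    · refine Finset.prod_congr rfl fun l hl => ?_
      rw [Finset.mem_range] at hl
      rw [Finset.prod_range_add]
      have hl' : ¬ (m + l < m) := by omega
      congr 1
      · refine Finset.prod_congr rfl fun j hj => ?_
        rw [Finset.mem_range] at hj
        rw [hz, lgPad_append_right x y l hl, lgPad_append_left x y j hj, if_neg hl', if_pos hj]
        simp
      · refine Finset.prod_congr rfl fun j hj => ?_
        rw [Finset.mem_range] at hj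
        rw [hz, lgPad_append_right x y l hl, lgPad_append_right x y j (by omega), if_neg hl',
          if_neg (by omega), abs_sub_comm]
        exact Even.pow_abs ⟨2, rfl⟩ _
  rw [h1, h3, ← h2]
  unfold lgR
  ring

theorem lgCol_prod (m k : ℕ) (y x : ℕ → ℝ) (v : ℕ → ℝ[X]) :
    ∏ j ∈ Finset.range (m + 2 * k), lgCol k y x j (v j) =
      (∏ l ∈ Finset.range k, lgEv (v (2 * l)) (y l) * lgEv (lgD (v (2 * l + 1))) (y l)) *
      ∏ i ∈ Finset.range m, lgEv (v (2 * k + i)) (x i) := by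
  rw [add_comm, Finset.prod_range_add]
  congr 1
  · have : ∀ n ≤ k, ∏ j ∈ Finset.range (2 * n), lgCol k y x j (v j) =
      ∏ l ∈ Finset.range n, lgEv (v (2 * l)) (y l) * lgEv (lgD (v (2 * l + 1))) (y l) := by
      intro n
      induction n with
      | zero => simp
      | succ n ih =>
        intro hn
        rw [show 2 * (n + 1) = 2 * n + 1 + 1 by ring, Finset.prod_range_succ, Finset.prod_range_succ,
          Finset.prod_range_succ, ih (by omega), mul_assoc]
        congr 2
        · rw [lgCol, if_pos (by omega), if_pos (by omega)]
          congr 2; omega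
        · rw [lgCol, if_pos (by omega), if_neg (by omega)]
          congr 2; omega
    exact this k le_rfl
  · refine Finset.prod_congr rfl fun i _ => ?_
    rw [lgCol, if_neg (by omega)]
    congr 2; omega

theorem lg_link (m k : ℕ) : Glg m k = lgK (m + 2 * k) k id := by
  unfold Glg
  rw [lg_int_append]
  simp only [lg_integrand, ← lgMat_det]
  have hdet : ∀ p : (Fin m → ℝ) × (Fin k → ℝ),
      lgP p.1 * (lgMat (m + 2 * k) k (lgPad p.2) (lgPad p.1)).det =
      ∑ s : Equiv.Perm (Fin (m + 2 * k)), ((Equiv.Perm.sign s : ℤ) : ℝ) *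
        (((∏ i : Fin m, lgEv (lgH (lgExt s (2 * k + i))) (p.1 i)) * lgP p.1) *
          ∏ l : Fin k, (lgEv (lgH (lgExt s (2 * l))) (p.2 l) * lgEv (lgD (lgH (lgExt s (2 * l + 1)))) (p.2 l))) := by
    intro p
    rw [Matrix.det_apply, Finset.mul_sum]
    refine Finset.sum_congr rfl fun s _ => ?_
    have e : ∏ i, lgMat (m + 2 * k) k (lgPad p.2) (lgPad p.1) (s i) i =
        ∏ j ∈ Finset.range (m + 2 * k), lgCol k (lgPad p.2) (lgPad p.1) j (lgH (lgExt s j)) := by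
      rw [Finset.prod_range]
      refine Finset.prod_congr rfl fun i _ => ?_
      simp [lgMat, lgExt]
    rw [e, lgCol_prod m k _ _ (fun j => lgH (lgExt s j)), Units.smul_def, zsmul_eq_mul]
    simp only [Finset.prod_range, lgPad_val]
    ring
  simp only [hdet]
  have hI1 : ∀ s : Equiv.Perm (Fin (m + 2 * k)), Integrable (fun x : Fin m → ℝ =>
      (∏ i : Fin m, lgEv (lgH (lgExt s (2 * k + i))) (x i)) * lgP x) := fun s =>
    lgL_int _ _ (fun i => lgEv_int _) lgP_meas lgP_le
  have hI2 : ∀ s : Equiv.Perm (Fin (m + 2 * k)), Integrable (fun y : Fin k → ℝ =>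
      ∏ l : Fin k, (lgEv (lgH (lgExt s (2 * l))) (y l) * lgEv (lgD (lgH (lgExt s (2 * l + 1)))) (y l))) :=
    fun s => Integrable.fintype_prod (f := fun (l : Fin k) (t : ℝ) =>
      lgEv (lgH (lgExt s (2 * l))) t * lgEv (lgD (lgH (lgExt s (2 * l + 1)))) t) fun l => lgEv_int2 _ _
  rw [integral_finsetSum _ (fun s _ => ?_)]
  · unfold lgK lgS
    refine Finset.sum_congr rfl fun s _ => ?_
    rw [integral_const_mul]
    congr 1
    rw [Measure.volume_eq_prod, integral_prod_mul (μ := volume) (ν := volume)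
      (fun x : Fin m → ℝ => (∏ i : Fin m, lgEv (lgH (lgExt s (2 * k + i))) (x i)) * lgP x)
      (fun y : Fin k → ℝ => ∏ l : Fin k, (lgEv (lgH (lgExt s (2 * l))) (y l) *
        lgEv (lgD (lgH (lgExt s (2 * l + 1)))) (y l))), mul_comm]
    congr 1
    · rw [integral_fintype_prod_volume_eq_prod (fun (l : Fin k) (t : ℝ) =>
        lgEv (lgH (lgExt s (2 * l))) t * lgEv (lgD (lgH (lgExt s (2 * l + 1)))) t)]
      unfold lgC lgG
      rw [Finset.prod_range]
    · rw [Nat.add_sub_cancel]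
      unfold lgL
      congr 1; ext x; congr 1
      refine Finset.prod_congr rfl fun i _ => ?_
      simp [lgO]
  · rw [Measure.volume_eq_prod]
    exact ((hI1 s).mul_prod (hI2 s)).const_mul _

end LG

/-- for positive integers `n, k` with `n ≥ 2k`, `G_{n-2k,k} = 2^{-2k} G_n`,
where `G_n = G_{n,0}` is the GOE partition function. -/
theorem stmt16 (n k : ℕ) (hk : 0 < k) (h : 2 * k ≤ n) :
    Glg (n - 2 * k) k = (2 : ℝ) ^ (-(2 * k : ℤ)) * Glg n 0 := by
  have e : (2 : ℝ) ^ (-(2 * k : ℤ)) = (1 / 4) ^ k := by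
    rw [zpow_neg, zpow_mul, zpow_natCast, ← inv_pow]; norm_num
  rw [lg_link, lg_link, Nat.sub_add_cancel h, lgK_main n k h, e]
  simp
end

section
/- For real numbers 2nc² ∈ (0,1), positive integers n > 2k, and a bounded interval A ⊂ (0,c₁) with 2nc₁² ∈ (0,1), the two-component log-gas integrals satisfy (1 - nc₁²)^k (2∫_A u du)^k G_{n-2k,k} ≤ E_{n,k,0}(A) ≤ (2∫_A u du)^k G_{n-2k,k}, where E_{n,k,0}(A) = ∫_{Σ_{n,k,A}} |J_n(λ)| dλ with Σ_{n,k,A} = {λ ∈ ℝ^n : |λ_j - λ_{j-k}| ∈ A for n-k < j ≤ n} and J_n(λ) = e^{-∑λ_i²/2} ∏_{j<i}(λ_i - λ_j). -/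
open MeasureTheory

/-- `E_{n,k,0}(A) = ∫_{Σ_{n,k,A}} |J_n(λ)| dλ`, where
`Σ_{n,k,A} = {λ ∈ ℝⁿ : |λ_j - λ_{j-k}| ∈ A for n-k < j ≤ n}` (1-based; here 0-based
indices `j` with `n - k ≤ j < n`) and `|J_n(λ)| = e^{-∑λᵢ²/2} ∏_{j<i} |λ_i - λ_j|`. -/
noncomputable def Eint (n k : ℕ) (A : Set ℝ) : ℝ :=
  ∫ lam in {l : Fin n → ℝ | ∀ j : Fin n, n - k ≤ (j : ℕ) →
      |l j - l ⟨(j : ℕ) - k, Nat.lt_of_le_of_lt (Nat.sub_le _ _) j.isLt⟩| ∈ A},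
    Real.exp (-∑ i : Fin n, lam i ^ 2 / 2) *
      ∏ p ∈ Finset.univ.filter (fun p : Fin n × Fin n => p.1 < p.2), |lam p.1 - lam p.2|

open Polynomial

namespace LG

lemma integrable_pol (p : ℝ[X]) : Integrable (fun x : ℝ => p.eval x * Real.exp (-x^2)) := by
  induction p using Polynomial.induction_on' with
  | add p q hp hq =>
    have := hp.add hq
    refine this.congr (Filter.Eventually.of_forall fun x => ?_)
    simp [add_mul]
  | monomial n a =>
    have h := (integrable_rpow_mul_exp_neg_mul_sq (b := 1) one_pos (s := n)
      (by have : (0:ℝ) ≤ n := n.cast_nonneg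
          linarith)).const_mul a
    refine h.congr (Filter.Eventually.of_forall fun x => ?_)
    simp [mul_assoc]

noncomputable def I : ℝ[X] →ₗ[ℝ] ℝ where
  toFun p := ∫ x : ℝ, p.eval x * Real.exp (-x^2)
  map_add' p q := by
    rw [← integral_add (integrable_pol p) (integrable_pol q)]
    simp [add_mul]
  map_smul' c p := by
    simp [mul_assoc, integral_const_mul]

lemma I_def (p : ℝ[X]) : I p = ∫ x : ℝ, p.eval x * Real.exp (-x^2) := rfl

lemma I_sq_nonneg (p : ℝ[X]) : 0 ≤ I (p * p) := by
  rw [I_def]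
  refine integral_nonneg fun x => ?_
  have := Real.exp_pos (-x^2)
  simp only [eval_mul, Pi.zero_apply]
  positivity [mul_self_nonneg (p.eval x)]

lemma I_parts (p : ℝ[X]) : I (derivative p) = 2 * I (X * p) := by
  have h := integral_eq_zero_of_hasDerivAt_of_integrable
    (f := fun x : ℝ => p.eval x * Real.exp (-x^2))
    (f' := fun x : ℝ => (derivative p - (2:ℝ) • (X * p)).eval x * Real.exp (-x^2)) ?_
    (integrable_pol _) (integrable_pol _)
  · have h2 : I (derivative p - (2:ℝ) • (X * p)) = 0 := h
    rw [map_sub, map_smul, smul_eq_mul] at h2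
    linarith
  · intro x
    have h1 := (p.hasDerivAt x).mul (((hasDerivAt_id x).pow 2).neg.exp)
    refine HasDerivAt.congr_deriv (f := fun x : ℝ => p.eval x * Real.exp (-x^2)) h1 ?_
    simp
    ring

lemma markov (N : ℕ) : ∀ p : ℝ[X], p.natDegree ≤ N →
    I (derivative p * derivative p) ≤ 2 * N * I (p * p) := by
  induction N with
  | zero =>
    intro p hp
    rw [Polynomial.eq_C_of_natDegree_le_zero hp]
    simp
  | succ N ih =>
    intro p hp
    have hq := ih (derivative p) ((natDegree_derivative_le p).trans (by omega))
    set q := derivative p with hqd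
    have h1 := I_parts (p * q)
    have h2 := I_parts (X * q * q)
    have h0 := I_sq_nonneg ((2:ℝ) • (X * q) - derivative q - (2 * (N+1) : ℝ) • p)
    have e0 : ((2:ℝ) • (X * q) - derivative q - (2 * (N+1) : ℝ) • p) *
        ((2:ℝ) • (X * q) - derivative q - (2 * (N+1) : ℝ) • p) =
        (4:ℝ) • (X * (X * q * q)) - (4:ℝ) • (X * q * derivative q) + derivative q * derivative q
        - (8 * (N+1) : ℝ) • (X * (p * q)) + (4 * (N+1) : ℝ) • (p * derivative q)
        + (4 * (N+1)^2 : ℝ) • (p * p) := by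
      simp only [Polynomial.smul_eq_C_mul, map_mul, map_add, map_pow, map_ofNat, map_one]
      ring
    have e1 : derivative (p * q) = q * q + p * derivative q := by
      rw [derivative_mul]
    have e2 : derivative (X * q * q) = q * q + (2:ℝ) • (X * q * derivative q) := by
      simp only [derivative_mul, derivative_X, Polynomial.smul_eq_C_mul, map_ofNat]
      ring
    rw [e0] at h0
    rw [e1] at h1
    rw [e2] at h2
    simp only [map_add, map_sub, map_smul, smul_eq_mul] at h0 h1 h2
    push_cast
    have hN : (0:ℝ) ≤ N := N.cast_nonneg
    have key : 0 ≤ (2 * (N+1) : ℝ) * (2 * (N+1) * I (p*p) - I (q*q)) := by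
      have hh : (8 * ((N:ℝ)+1)) * I (X * (p*q)) = (4 * (N+1)) * (I (q*q) + I (p * derivative q)) := by
        rw [h1]; ring
      nlinarith
    have := nonneg_of_mul_nonneg_right key (by positivity)
    linarith

lemma deriv_bound (N : ℕ) (p : ℝ[X]) (hp : p.natDegree ≤ N) :
    I ((derivative p - X * p) * (derivative p - X * p)) ≤ (2 * N + 1) * I (p * p) := by
  have h1 := markov N p hp
  have h2 := I_parts (X * p * p)
  have h3 := I_sq_nonneg (X * p)
  have e1 : (derivative p - X * p) * (derivative p - X * p) =
    derivative p * derivative p - (2:ℝ) • (X * p * derivative p) + (X * p) * (X * p) := by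
    simp only [Polynomial.smul_eq_C_mul, map_ofNat]
    ring
  have e2 : derivative (X * p * p) = p * p + (2:ℝ) • (X * p * derivative p) := by
    simp only [derivative_mul, derivative_X, Polynomial.smul_eq_C_mul, map_ofNat]
    ring
  have e3 : X * (X * p * p) = (X * p) * (X * p) := by ring
  rw [e2, e3] at h2
  rw [e1]
  simp only [map_add, map_sub, map_smul, smul_eq_mul] at h2 ⊢
  linarith

/-- Hermite-type function -/
noncomputable def g (p : ℝ[X]) (x : ℝ) : ℝ := Real.exp (-x^2/2) * p.eval x

lemma g_cont (p : ℝ[X]) : Continuous (g p) := by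
  unfold g
  fun_prop

lemma g_mul (p q : ℝ[X]) (x : ℝ) : g p x * g q x = (p * q).eval x * Real.exp (-x^2) := by
  have : Real.exp (-x^2) = Real.exp (-x^2/2) * Real.exp (-x^2/2) := by
    rw [← Real.exp_add]; congr 1; ring
  rw [this, eval_mul]; unfold g; ring

lemma g_sq_int (p : ℝ[X]) : Integrable (fun x => g p x ^ 2) := by
  refine (integrable_pol (p * p)).congr (Filter.Eventually.of_forall fun x => ?_)
  simp only [← g_mul]; ring

lemma g_sq_integral (p : ℝ[X]) : ∫ x, g p x ^ 2 = I (p * p) := by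
  rw [I_def]
  simp only [← g_mul]
  simp only [sq]

lemma g_deriv (p : ℝ[X]) (x : ℝ) : HasDerivAt (g p) (g (derivative p - X * p) x) x := by
  have h1 := ((((hasDerivAt_id x).pow 2).neg.div_const 2).exp).mul (p.hasDerivAt x)
  refine HasDerivAt.congr_deriv (f := g p) h1 ?_
  simp [g]
  ring

lemma shift_bound (p : ℝ[X]) (u : ℝ) (hu : 0 ≤ u) :
    ∫⁻ x, ENNReal.ofReal ((g p (x+u) - g p x)^2) ≤
      ENNReal.ofReal (u^2 * I ((derivative p - X * p) * (derivative p - X * p))) := by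
  set q := derivative p - X * p
  have pt : ∀ x, (g p (x+u) - g p x)^2 ≤ u * ∫ s in Set.Ioc 0 u, g q (x+s)^2 := by
    intro x
    have hc : Continuous fun s => g q (x+s) := (g_cont q).comp (by fun_prop)
    have h1 : ∫ s in (0:ℝ)..u, g q (x+s) = g p (x+u) - g p x := by
      have := intervalIntegral.integral_eq_sub_of_hasDerivAt (a := 0) (b := u)
        (f := fun s => g p (x+s)) (f' := fun s => g q (x+s))
        (fun s _ => (g_deriv p (x+s)).comp_const_add x s) (hc.intervalIntegrable _ _)
      simpa using this
    rw [← h1, ← intervalIntegral.integral_of_le hu]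
    set m := ∫ s in (0:ℝ)..u, g q (x+s) with hm
    rcases hu.eq_or_lt with h | h
    · subst h; simp [hm]
    have h2 : 0 ≤ ∫ s in (0:ℝ)..u, (g q (x+s) - m/u)^2 :=
      intervalIntegral.integral_nonneg hu fun s _ => sq_nonneg _
    have h3 : ∫ s in (0:ℝ)..u, (g q (x+s) - m/u)^2 =
      (∫ s in (0:ℝ)..u, g q (x+s)^2) - (2 * (m/u)) * m + u * (m/u)^2 := by
      have : ∀ s, (g q (x+s) - m/u)^2 = g q (x+s)^2 - (2*(m/u)) * g q (x+s) + (m/u)^2 := by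
        intro s; ring
      simp only [this]
      rw [intervalIntegral.integral_add, intervalIntegral.integral_sub,
        intervalIntegral.integral_const_mul, ← hm]
      · simp
      all_goals exact Continuous.intervalIntegrable (by fun_prop) _ _
    rw [h3] at h2
    have h4 : u * ((∫ s in (0:ℝ)..u, g q (x+s)^2) - (2 * (m/u)) * m + u * (m/u)^2) =
      u * (∫ s in (0:ℝ)..u, g q (x+s)^2) - m^2 := by
      field_simp; ring
    have := mul_nonneg hu h2
    linarith
  have hgc : Continuous (g q) := g_cont q
  calc ∫⁻ x, ENNReal.ofReal ((g p (x+u) - g p x)^2)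
      ≤ ∫⁻ x, ENNReal.ofReal u * ∫⁻ s in Set.Ioc 0 u, ENNReal.ofReal (g q (x+s)^2) := by
        refine lintegral_mono fun x => ?_
        refine (ENNReal.ofReal_le_ofReal (pt x)).trans ?_
        rw [ENNReal.ofReal_mul hu, ofReal_integral_eq_lintegral_ofReal]
        · have hc : Continuous fun s => g q (x+s)^2 := by fun_prop
          exact (hc.integrableOn_Icc).mono_set Set.Ioc_subset_Icc_self
        · exact Filter.Eventually.of_forall fun s => sq_nonneg _
    _ = ENNReal.ofReal u * ∫⁻ s in Set.Ioc 0 u, ∫⁻ x, ENNReal.ofReal (g q (x+s)^2) := by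
        rw [lintegral_const_mul', lintegral_lintegral_swap]
        · refine Measurable.aemeasurable ?_
          simp only [Function.uncurry_def]
          exact Measurable.ennreal_ofReal (Continuous.measurable (by fun_prop))
        · simp
    _ = ENNReal.ofReal u * ∫⁻ s in Set.Ioc 0 u, ENNReal.ofReal (I (q*q)) := by
        congr 1
        refine lintegral_congr fun s => ?_
        rw [lintegral_add_right_eq_self (fun x => ENNReal.ofReal (g q x ^2)) s,
          ← ofReal_integral_eq_lintegral_ofReal (g_sq_int q)
            (Filter.Eventually.of_forall fun s => sq_nonneg _), g_sq_integral]
    _ = _ := by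
        simp only [lintegral_const, Measure.restrict_apply MeasurableSet.univ, Set.univ_inter,
          Real.volume_Ioc, sub_zero]
        rw [mul_comm (ENNReal.ofReal (I _)), ← mul_assoc, ← ENNReal.ofReal_mul hu,
          ← ENNReal.ofReal_mul (by positivity), sq]

lemma gg_int (p : ℝ[X]) (u : ℝ) : Integrable (fun x => |g p x| * |g p (x+u)|) := by
  have hgc := g_cont p
  refine ((g_sq_int p).add ((g_sq_int p).comp_add_right u)).mono'
    (Continuous.aestronglyMeasurable (by fun_prop)) (Filter.Eventually.of_forall fun x => ?_)
  simp only [norm_mul, norm_abs_eq_norm, Real.norm_eq_abs, Pi.add_apply]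
  have := sq_abs (g p x)
  have := sq_abs (g p (x+u))
  nlinarith [sq_nonneg (|g p x| - |g p (x+u)|), sq_nonneg (g p x), sq_nonneg (g p (x+u))]

lemma lint_sq (p : ℝ[X]) : ∫⁻ x, ENNReal.ofReal (|g p x| * |g p x|) = ENNReal.ofReal (I (p*p)) := by
  rw [← g_sq_integral, ofReal_integral_eq_lintegral_ofReal (g_sq_int p)
            (Filter.Eventually.of_forall fun s => sq_nonneg _)]
  simp [← sq]

lemma one_upper (p : ℝ[X]) (u : ℝ) :
    ∫⁻ x, ENNReal.ofReal (|g p x| * |g p (x+u)|) ≤ ∫⁻ x, ENNReal.ofReal (|g p x| * |g p x|) := by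
  rw [lint_sq, ← ofReal_integral_eq_lintegral_ofReal (gg_int p u)
            (Filter.Eventually.of_forall fun s => by positivity)]
  refine ENNReal.ofReal_le_ofReal ?_
  have h1 : ∫ x, |g p x| * |g p (x+u)| ≤ ∫ x, ((1/2) * g p x ^2 + (1/2) * g p (x+u)^2) := by
    refine integral_mono (gg_int p u) (((g_sq_int p).const_mul _).add
      (((g_sq_int p).comp_add_right u).const_mul _)) fun x => ?_
    have := sq_abs (g p x)
    have := sq_abs (g p (x+u))
    simp only
    nlinarith [sq_nonneg (|g p x| - |g p (x+u)|)]
  rw [integral_add ((g_sq_int p).const_mul _)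
      (((g_sq_int p).comp_add_right u).const_mul _), integral_const_mul, integral_const_mul,
      integral_add_right_eq_self (fun x => g p x ^2), g_sq_integral] at h1
  linarith

lemma one_lower_pos (N : ℕ) (p : ℝ[X]) (hp : p.natDegree ≤ N) (u : ℝ) (hu : 0 ≤ u) :
    (1 - (2*N+1) * u^2/2) * I (p*p) ≤ ∫ x, |g p x| * |g p (x+u)| := by
  have hb := shift_bound p u hu
  have hd := deriv_bound N p hp
  have hgc := g_cont p
  have hi : Integrable (fun x => (g p (x+u) - g p x)^2) := by
    refine (((g_sq_int p).const_mul 2).add (((g_sq_int p).comp_add_right u).const_mul 2)).mono'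
      (Continuous.aestronglyMeasurable (by fun_prop)) (Filter.Eventually.of_forall fun x => ?_)
    rw [Real.norm_eq_abs, abs_of_nonneg (sq_nonneg (g p (x+u) - g p x)), Pi.add_apply]
    nlinarith [sq_nonneg (g p (x+u) + g p x)]
  rw [← ofReal_integral_eq_lintegral_ofReal hi (Filter.Eventually.of_forall fun s => sq_nonneg _),
    ENNReal.ofReal_le_ofReal_iff (mul_nonneg (sq_nonneg _) (I_sq_nonneg _))] at hb
  have h1 : ∫ x, ((1/2) * g p x ^2 + (1/2) * g p (x+u)^2 - (1/2) * (g p (x+u) - g p x)^2)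
      ≤ ∫ x, |g p x| * |g p (x+u)| := by
    refine integral_mono ((((g_sq_int p).const_mul _).add
      (((g_sq_int p).comp_add_right u).const_mul _)).sub (hi.const_mul _)) (gg_int p u) fun x => ?_
    simp only [← abs_mul]
    have := le_abs_self (g p x * g p (x+u))
    nlinarith
  rw [integral_sub (f := fun x => (1/2) * g p x ^2 + (1/2) * g p (x+u)^2)
      (((g_sq_int p).const_mul _).add
      (((g_sq_int p).comp_add_right u).const_mul _)) (hi.const_mul _),
      integral_add ((g_sq_int p).const_mul _)
      (((g_sq_int p).comp_add_right u).const_mul _), integral_const_mul, integral_const_mul,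
      integral_const_mul,
      integral_add_right_eq_self (fun x => g p x ^2), g_sq_integral] at h1
  have h2 := mul_le_mul_of_nonneg_left hd (sq_nonneg u)
  linarith

lemma one_lower (N : ℕ) (p : ℝ[X]) (hp : p.natDegree ≤ N) (u : ℝ) (d : ℝ)
    (hd : d ≤ 1 - (2*N+1) * u^2/2) :
    ENNReal.ofReal d * ∫⁻ x, ENNReal.ofReal (|g p x| * |g p x|) ≤
      ∫⁻ x, ENNReal.ofReal (|g p x| * |g p (x+u)|) := by
  rw [lint_sq, ← ofReal_integral_eq_lintegral_ofReal (gg_int p u)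
            (Filter.Eventually.of_forall fun s => by positivity),
     ← ENNReal.ofReal_mul' (I_sq_nonneg _)]
  refine ENNReal.ofReal_le_ofReal ((mul_le_mul_of_nonneg_right hd (I_sq_nonneg _)).trans ?_)
  rcases le_total 0 u with h | h
  · exact one_lower_pos N p hp u h
  · have := one_lower_pos N p hp (-u) (by linarith)
    rw [← integral_add_right_eq_self _ u] at this
    simpa [mul_comm] using this

section alg
variable {s k : ℕ}

def base (s k : ℕ) : Fin (s+k+k) → Fin (s+k) := Fin.addCases id (Fin.natAdd s)
def sh (u : Fin k → ℝ) : Fin (s+k+k) → ℝ := Fin.addCases (fun _ => 0) u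
def w (u : Fin k → ℝ) (z : Fin (s+k) → ℝ) (a : Fin (s+k+k)) : ℝ := z (base s k a) + sh u a

@[simp] lemma base_c (i : Fin (s+k)) : base s k (Fin.castAdd k i) = i := by simp [base]
@[simp] lemma base_n (i : Fin k) : base s k (Fin.natAdd (s+k) i) = Fin.natAdd s i := by simp [base]
@[simp] lemma sh_c (u : Fin k → ℝ) (i : Fin (s+k)) : sh u (Fin.castAdd k i) = 0 := by simp [sh]
@[simp] lemma sh_n (u : Fin k → ℝ) (i : Fin k) : sh (s := s) u (Fin.natAdd (s+k) i) = u i := by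
  simp [sh]

lemma cn_ne (i : Fin (s+k)) (j : Fin k) : Fin.castAdd k i ≠ Fin.natAdd (s+k) j := by
  intro h
  have h2 : (i : ℕ) = s + k + j := congrArg Fin.val h
  have := i.isLt
  omega

noncomputable def gg (u : Fin k → ℝ) (z : Fin (s+k) → ℝ) (a b : Fin (s+k+k)) : ℝ :=
  if base s k a = base s k b then 1 else |w u z a - w u z b|

lemma gg_nonneg (u : Fin k → ℝ) (z : Fin (s+k) → ℝ) (a b) : 0 ≤ gg u z a b := by
  unfold gg; split_ifs <;> positivity

lemma gg_symm (u : Fin k → ℝ) (z : Fin (s+k) → ℝ) (a b) : gg u z a b = gg u z b a := by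
  unfold gg; rw [abs_sub_comm]; simp only [eq_comm]

noncomputable def Phi (u : Fin k → ℝ) (z : Fin (s+k) → ℝ) : ℝ :=
  Real.exp (-∑ a, w u z a ^ 2 / 2) * Real.sqrt (∏ a, ∏ b, gg u z a b)

lemma Phi_nonneg (u : Fin k → ℝ) (z : Fin (s+k) → ℝ) : 0 ≤ Phi u z := by
  unfold Phi; positivity

lemma w_cont (a : Fin (s+k+k)) :
    Continuous (fun q : (Fin (s+k) → ℝ) × (Fin k → ℝ) => w q.2 q.1 a) := by
  unfold w
  refine Continuous.add (by fun_prop) ?_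
  refine Fin.addCases (fun i => ?_) (fun i => ?_) a
  · simp; fun_prop
  · simp; fun_prop

lemma Phi_cont : Continuous (fun q : (Fin (s+k) → ℝ) × (Fin k → ℝ) => Phi q.2 q.1) := by
  unfold Phi
  have := w_cont (s := s) (k := k)
  refine Continuous.mul (by fun_prop) (Continuous.sqrt ?_)
  refine continuous_finsetProd _ fun a _ => continuous_finsetProd _ fun b _ => ?_
  unfold gg
  split_ifs
  · fun_prop
  · fun_prop

lemma pair_prod {m : ℕ} (h : Fin m → Fin m → ℝ) (h0 : ∀ a b, 0 ≤ h a b)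
    (hs : ∀ a b, h a b = h b a) :
    ∏ p ∈ Finset.univ.filter (fun p : Fin m × Fin m => p.1 < p.2), h p.1 p.2 =
      Real.sqrt (∏ a, ∏ b, if a = b then 1 else h a b) := by
  have e1 : (∏ a, ∏ b, if a = b then 1 else h a b) =
      (∏ p ∈ Finset.univ.filter (fun p : Fin m × Fin m => p.1 < p.2), h p.1 p.2) ^ 2 := by
    rw [← Fintype.prod_prod_type' (fun a b => if a = b then 1 else h a b), Finset.prod_filter, sq]
    conv_rhs => rhs; rw [← (Equiv.prodComm (Fin m) (Fin m)).prod_comp]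
    rw [← Finset.prod_mul_distrib]
    refine Finset.prod_congr rfl fun p _ => ?_
    obtain ⟨a, b⟩ := p
    simp only [Equiv.prodComm_apply, Prod.swap]
    rcases lt_trichotomy a b with h | h | h
    · simp [h, h.ne, h.not_gt]
    · simp [h]
    · simp [h, h.ne', h.not_gt, hs a b]
  rw [e1, Real.sqrt_sq (Finset.prod_nonneg fun p _ => h0 _ _)]

lemma fact1 (u : Fin k → ℝ) (z : Fin (s+k) → ℝ) :
    Real.exp (-∑ a, w u z a ^ 2 / 2) *
      ∏ p ∈ Finset.univ.filter (fun p : Fin (s+k+k) × Fin (s+k+k) => p.1 < p.2),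
        |w u z p.1 - w u z p.2| = (∏ j, |u j|) * Phi u z := by
  rw [pair_prod (fun a b => |w u z a - w u z b|) (fun _ _ => abs_nonneg _)
    (fun _ _ => abs_sub_comm _ _)]
  have e : (∏ a, ∏ b, if a = b then 1 else |w u z a - w u z b|) =
      (∏ j, |u j|)^2 * (∏ a, ∏ b, gg u z a b) := by
    have pt : ∀ a b, (if a = b then 1 else |w u z a - w u z b|) =
      (if a ≠ b ∧ base s k a = base s k b then |w u z a - w u z b| else 1) * gg u z a b := by
      intro a b
      unfold gg
      by_cases h1 : a = b
      · simp [h1]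
      · by_cases h2 : base s k a = base s k b <;> simp [h1, h2]
    simp only [pt, Finset.prod_mul_distrib]
    congr 1
    have c1 : ∀ i i' : Fin (s+k), (if Fin.castAdd k i ≠ Fin.castAdd k i' ∧ i = i' then
      |w u z (Fin.castAdd k i) - w u z (Fin.castAdd k i')| else 1) = 1 := by
      intro i i'; rw [if_neg]; rintro ⟨h, rfl⟩; exact h rfl
    have c2 : ∀ i i' : Fin k, (if Fin.natAdd (s+k) i ≠ Fin.natAdd (s+k) i' ∧
        Fin.natAdd s i = Fin.natAdd s i' then
      |w u z (Fin.natAdd (s+k) i) - w u z (Fin.natAdd (s+k) i')| else 1) = 1 := by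
      intro i i'; rw [if_neg]; rintro ⟨h, h'⟩
      apply h; simpa [Fin.ext_iff] using h'
    have c3 : ∀ (i : Fin (s+k)) (j : Fin k), (if Fin.castAdd k i ≠ Fin.natAdd (s+k) j ∧
        i = Fin.natAdd s j then
      |w u z (Fin.castAdd k i) - w u z (Fin.natAdd (s+k) j)| else 1) =
        if i = Fin.natAdd s j then |u j| else 1 := by
      intro i j
      by_cases h : i = Fin.natAdd s j
      · subst h
        rw [if_pos ⟨cn_ne _ _, rfl⟩, if_pos rfl]
        simp [w]
      · simp [h]
    have c4 : ∀ (i : Fin (s+k)) (j : Fin k), (if Fin.natAdd (s+k) j ≠ Fin.castAdd k i ∧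
        Fin.natAdd s j = i then
      |w u z (Fin.natAdd (s+k) j) - w u z (Fin.castAdd k i)| else 1) =
        if i = Fin.natAdd s j then |u j| else 1 := by
      intro i j
      rw [← c3, abs_sub_comm]; simp only [ne_comm, eq_comm]
    rw [Fin.prod_univ_add]
    simp only [Fin.prod_univ_add (a := s+k) (b := k), base_c, base_n, c1, c2, c3, c4,
      Finset.prod_const_one, one_mul, mul_one]
    rw [Finset.prod_comm]
    simp [sq]
  rw [e, Real.sqrt_mul (sq_nonneg _), Real.sqrt_sq (Finset.prod_nonneg fun _ _ => abs_nonneg _)]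
  unfold Phi; ring

lemma prod_base (H : Fin (s+k) → ℝ) :
    ∏ a, H (base s k a) = ∏ i : Fin (s+k), H i ^ (if (i : ℕ) < s then 1 else 2) := by
  rw [Fin.prod_univ_add]
  simp only [base_c, base_n]
  rw [Fin.prod_univ_add, Fin.prod_univ_add (a := s) (b := k)]
  simp [Finset.prod_mul_distrib, sq, mul_assoc]

lemma sum_base (H : Fin (s+k) → ℝ) :
    ∑ a, H (base s k a) = ∑ i : Fin (s+k), (if (i : ℕ) < s then 1 else 2) * H i := by
  rw [Fin.sum_univ_add]
  simp only [base_c, base_n]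
  rw [Fin.sum_univ_add, Fin.sum_univ_add (a := s) (b := k)]
  simp [two_mul, Finset.sum_add_distrib, add_assoc]

/-- integrand of G -/
noncomputable def Gi (s k : ℕ) (lam : Fin (s+k) → ℝ) : ℝ :=
    Real.exp (-∑ i : Fin (s + k), (if (i : ℕ) < s then (1 : ℝ) else 2) * lam i ^ 2 / 2) *
      ∏ p ∈ Finset.univ.filter (fun p : Fin (s + k) × Fin (s + k) => p.1 < p.2),
        |lam p.1 - lam p.2| ^
          ((if (p.1 : ℕ) < s then 1 else 2) * (if (p.2 : ℕ) < s then 1 else 2))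

lemma w_zero (z : Fin (s+k) → ℝ) (a) : w (0 : Fin k → ℝ) z a = z (base s k a) := by
  unfold w
  refine Fin.addCases (fun i => ?_) (fun i => ?_) a <;> simp

lemma fact2 (z : Fin (s+k) → ℝ) : Phi 0 z = Gi s k z := by
  unfold Gi Phi
  rw [pair_prod (fun a b => |z a - z b| ^
          ((if (a : ℕ) < s then 1 else 2) * (if (b : ℕ) < s then 1 else 2)))
      (fun _ _ => by positivity) (fun a b => by rw [abs_sub_comm, mul_comm])]
  congr 2
  · simp only [w_zero]
    rw [sum_base (fun i => z i ^2/2)]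
    simp only [mul_div_assoc]
  · unfold gg
    simp only [w_zero]
    rw [prod_base (fun i => ∏ b, if i = base s k b then 1 else |z i - z (base s k b)|)]
    refine Finset.prod_congr rfl fun i _ => ?_
    rw [prod_base (fun i' => if i = i' then 1 else |z i - z i'|), ← Finset.prod_pow]
    refine Finset.prod_congr rfl fun i' _ => ?_
    by_cases h : i = i'
    · simp [h]
    · rw [if_neg h, if_neg h, ← pow_mul, mul_comm]

lemma slice (u : Fin k → ℝ) (z : Fin (s+k) → ℝ) (j : Fin k) :
    ∃ p : ℝ[X], p.natDegree ≤ s+k+k-1 ∧ ∃ C : ℝ, 0 ≤ C ∧ ∀ t v,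
      Phi (Function.update u j v) (Function.update z (Fin.natAdd s j) t) =
        C * (|g p t| * |g p (t+v)|) := by
  classical
  set T : Finset (Fin (s+k+k)) := {a | base s k a = Fin.natAdd s j} with hT
  have memT : ∀ a, a ∈ T ↔ base s k a = Fin.natAdd s j := by simp [hT]
  refine ⟨∏ b ∈ Tᶜ, (X - C (w u z b)), ?_, Real.exp (-∑ a ∈ Tᶜ, w u z a ^ 2 / 2) *
    Real.sqrt (∏ a ∈ Tᶜ, ∏ b ∈ Tᶜ, gg u z a b), by positivity, ?_⟩
  · rw [natDegree_finsetProd_X_sub_C_eq_card]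
    have h1 : Fin.natAdd (s+k) j ∈ T := by simp [memT]
    have := Finset.card_pos.2 ⟨_, h1⟩
    have h3 := Finset.card_compl T
    simp only [Fintype.card_fin] at h3
    omega
  intro t v
  have hw : ∀ b ∈ Tᶜ, w (Function.update u j v) (Function.update z (Fin.natAdd s j) t) b =
      w u z b := by
    intro b hb
    rw [Finset.mem_compl, memT] at hb
    unfold w
    rw [Function.update_of_ne hb]
    congr 1
    revert hb
    refine Fin.addCases (fun i => ?_) (fun i => ?_) b
    · simp
    · intro h
      simp only [base_n] at h
      have : i ≠ j := fun h' => h (by rw [h'])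
      simp [this]
  set u' := Function.update u j v with hu'
  set z' := Function.update z (Fin.natAdd s j) t with hz'
  have hg : ∀ a ∈ Tᶜ, ∀ b ∈ Tᶜ, gg u' z' a b = gg u z a b := by
    intro a ha b hb
    unfold gg
    rw [hw a ha, hw b hb]
  have hTT : T = {Fin.castAdd k (Fin.natAdd s j), Fin.natAdd (s+k) j} := by
    ext a
    rw [memT, Finset.mem_insert, Finset.mem_singleton]
    refine Fin.addCases (fun i => ?_) (fun i => ?_) a
    · have : Fin.castAdd k i ≠ Fin.natAdd (s+k) j := cn_ne _ _
      simp [this]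
    · have : Fin.natAdd (s+k) i ≠ Fin.castAdd k (Fin.natAdd s j) := (cn_ne _ _).symm
      simp [this, Fin.ext_iff]
  have hne : Fin.castAdd k (Fin.natAdd s j) ≠ Fin.natAdd (s+k) j := cn_ne _ _
  have wa : w u' z' (Fin.castAdd k (Fin.natAdd s j)) = t := by simp [w, hz']
  have wb : w u' z' (Fin.natAdd (s+k) j) = t + v := by simp [w, hz', hu']
  set D := ∏ a ∈ Tᶜ, ∏ b ∈ Tᶜ, gg u z a b with hD
  have hD0 : 0 ≤ D := Finset.prod_nonneg fun a _ => Finset.prod_nonneg fun b _ => gg_nonneg _ _ _ _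
  have hprod : ∏ a, ∏ b, gg u' z' a b =
      (∏ a ∈ T, ∏ b ∈ Tᶜ, |w u' z' a - w u z b|)^2 * D := by
    have hcross : ∏ a ∈ T, ∏ b ∈ Tᶜ, gg u' z' a b = ∏ a ∈ T, ∏ b ∈ Tᶜ, |w u' z' a - w u z b| := by
      refine Finset.prod_congr rfl fun a ha => Finset.prod_congr rfl fun b hb => ?_
      rw [← hw b hb, gg, if_neg]
      rw [Finset.mem_compl, memT] at hb
      rw [(memT a).1 ha]
      exact fun h => hb h.symm
    have hin : ∏ a ∈ T, ∏ b ∈ T, gg u' z' a b = 1 := by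
      refine Finset.prod_eq_one fun a ha => Finset.prod_eq_one fun b hb => ?_
      rw [gg, if_pos]
      rw [(memT a).1 ha, (memT b).1 hb]
    have hcross2 : ∏ a ∈ Tᶜ, ∏ b ∈ T, gg u' z' a b = ∏ a ∈ T, ∏ b ∈ Tᶜ, |w u' z' a - w u z b| := by
      rw [← hcross, Finset.prod_comm]
      simp only [gg_symm u' z']
    have hout : ∏ a ∈ Tᶜ, ∏ b ∈ Tᶜ, gg u' z' a b = D :=
      Finset.prod_congr rfl fun a ha => Finset.prod_congr rfl fun b hb => hg a ha b hb
    rw [← Finset.prod_mul_prod_compl T]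
    simp only [← Finset.prod_mul_prod_compl T (fun b => gg u' z' _ b)]
    rw [Finset.prod_mul_distrib, Finset.prod_mul_distrib, hin, hcross, hcross2, hout]
    ring
  unfold Phi
  rw [hprod, Real.sqrt_mul (sq_nonneg _), Real.sqrt_sq (Finset.prod_nonneg fun a _ =>
    Finset.prod_nonneg fun b _ => abs_nonneg _)]
  have hsum : ∑ a, w u' z' a ^ 2 / 2 = t^2/2 + (t+v)^2/2 + ∑ a ∈ Tᶜ, w u z a ^ 2/2 := by
    rw [← Finset.sum_add_sum_compl T]
    congr 1
    · rw [hTT, Finset.sum_pair hne, wa, wb]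
    · exact Finset.sum_congr rfl fun a ha => by rw [hw a ha]
  have hgp : ∀ x, |g (∏ b ∈ Tᶜ, (X - C (w u z b))) x| =
      Real.exp (-(x^2/2)) * ∏ b ∈ Tᶜ, |x - w u z b| := by
    intro x
    unfold g
    rw [abs_mul, abs_of_pos (Real.exp_pos _), eval_prod, Finset.abs_prod]
    simp [neg_div]
  have hTp : ∏ a ∈ T, ∏ b ∈ Tᶜ, |w u' z' a - w u z b| =
      (∏ b ∈ Tᶜ, |t - w u z b|) * ∏ b ∈ Tᶜ, |t + v - w u z b| := by
    have : ∀ S : Finset (Fin (s+k+k)), ∏ a ∈ T, ∏ b ∈ S, |w u' z' a - w u z b| =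
      (∏ b ∈ S, |t - w u z b|) * ∏ b ∈ S, |t + v - w u z b| := by
      intro S
      rw [hTT, Finset.prod_pair hne, wa, wb]
    exact this _
  rw [hsum, hgp, hgp, hTp, neg_add, neg_add, Real.exp_add, Real.exp_add]
  ring

end alg

section steps
variable {s k : ℕ}

noncomputable def M (s : ℕ) (u : Fin k → ℝ) : ENNReal :=
  ∫⁻ z : Fin (s+k) → ℝ, ENNReal.ofReal (Phi u z)

lemma Phi_meas (u : Fin k → ℝ) : Measurable (fun z : Fin (s+k) → ℝ => ENNReal.ofReal (Phi u z)) :=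
  (Phi_cont.comp (f := fun z : Fin (s+k) → ℝ => (z, u)) (by fun_prop)).measurable.ennreal_ofReal

lemma step (u : Fin k → ℝ) (j : Fin k) (d : ℝ) (hd : d ≤ 1 - (s+k+k : ℕ) * (u j)^2) :
    M s u ≤ M s (Function.update u j 0) ∧
    ENNReal.ofReal d * M s (Function.update u j 0) ≤ M s u := by
  have hm0 := Phi_meas (s := s) u
  have hm1 := Phi_meas (s := s) (Function.update u j 0)
  have hc0 : ∀ p : ℝ[X], ∀ v, Measurable fun t => ENNReal.ofReal (|g p t| * |g p (t+v)|) := by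
    intro p v
    have := g_cont p
    exact (Continuous.measurable (by fun_prop)).ennreal_ofReal
  constructor
  · refine lintegral_le_of_lmarginal_le (μ := fun _ => volume) {Fin.natAdd s j} hm0 hm1 ?_
    intro z
    rw [lmarginal_singleton, lmarginal_singleton]
    obtain ⟨p, hp, C, hC, h⟩ := slice u z j
    have h1 := fun t => h t (u j)
    have h2 := fun t => h t 0
    simp only [Function.update_eq_self] at h1
    simp only [h1, h2, ENNReal.ofReal_mul hC, add_zero]
    rw [lintegral_const_mul _ (hc0 _ _), lintegral_const_mul _ (by simpa using hc0 p 0)]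
    refine mul_le_mul_right ?_ _
    exact one_upper p (u j)
  · unfold M
    rw [← lintegral_const_mul _ hm1]
    refine lintegral_le_of_lmarginal_le (μ := fun _ => volume) {Fin.natAdd s j}
      (hm1.const_mul _) hm0 ?_
    intro z
    rw [lmarginal_singleton, lmarginal_singleton]
    obtain ⟨p, hp, C, hC, h⟩ := slice u z j
    have h1 := fun t => h t (u j)
    have h2 := fun t => h t 0
    simp only [Function.update_eq_self] at h1
    simp only [h1, h2, ENNReal.ofReal_mul hC, add_zero]
    have hcc : Measurable fun t => ENNReal.ofReal (|g p t| * |g p t|) := by simpa using hc0 p 0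
    rw [lintegral_const_mul _ (hcc.const_mul _), lintegral_const_mul _ (hc0 _ _),
      lintegral_const_mul _ hcc, mul_left_comm]
    refine mul_le_mul_right ?_ _
    refine one_lower (s+k+k-1) p hp (u j) d (hd.trans ?_)
    have : ((s+k+k-1 : ℕ) : ℝ) + 1 = (s+k+k : ℕ) := by
      have : s+k+k-1+1 = s+k+k := by have := j.pos; omega
      exact_mod_cast this
    have := sq_nonneg (u j)
    nlinarith

lemma steps (u : Fin k → ℝ) (d : ℝ) (hd : ∀ j, d ≤ 1 - (s+k+k : ℕ) * (u j)^2) :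
    M s u ≤ M s (0 : Fin k → ℝ) ∧
    ENNReal.ofReal d ^ k * M s (0 : Fin k → ℝ) ≤ M s u := by
  classical
  have key : ∀ J : Finset (Fin k), M s u ≤ M s (fun j => if j ∈ J then 0 else u j) ∧
    ENNReal.ofReal d ^ J.card * M s (fun j => if j ∈ J then 0 else u j) ≤ M s u := by
    intro J
    induction J using Finset.induction_on with
    | empty => simp
    | insert i J hi ih =>
      have e : (fun j => if j ∈ insert i J then 0 else u j) =
        Function.update (fun j => if j ∈ J then 0 else u j) i 0 := by
        ext j
        by_cases h : j = i
        · subst h; simp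
        · simp [h]
      obtain ⟨h1, h2⟩ := step (s := s) (fun j => if j ∈ J then 0 else u j) i d
        (by simpa [hi] using hd i)
      rw [e, Finset.card_insert_of_notMem hi, pow_succ, mul_assoc]
      exact ⟨ih.1.trans h1, le_trans (by gcongr) ih.2⟩
  have h := key Finset.univ
  have e : (fun j : Fin k => if j ∈ Finset.univ then 0 else u j) = 0 := by ext j; simp
  rw [e] at h
  simpa using h

end steps

section fin
variable {s k : ℕ}

lemma integrable_pol2 (p : ℝ[X]) : Integrable (fun x : ℝ => p.eval x * Real.exp (-x^2/2)) := by
  induction p using Polynomial.induction_on' with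
  | add p q hp hq =>
    have := hp.add hq
    refine this.congr (Filter.Eventually.of_forall fun x => ?_)
    simp [add_mul]
  | monomial n a =>
    have h := (integrable_rpow_mul_exp_neg_mul_sq (b := 1/2) (by norm_num) (s := n)
      (by have : (0:ℝ) ≤ n := n.cast_nonneg
          linarith)).const_mul a
    refine h.congr (Filter.Eventually.of_forall fun x => ?_)
    have : -(1/2) * x^2 = -x^2/2 := by ring
    simp only [this]
    simp [mul_assoc]

lemma one_le_prod_aux {ι : Type*} (S : Finset ι) (f : ι → ℝ) (h : ∀ i, 1 ≤ f i) :
    1 ≤ ∏ i ∈ S, f i := by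
  have := Finset.prod_le_prod (s := S) (f := fun _ => (1:ℝ)) (g := f)
    (fun _ _ => zero_le_one) (fun i _ => h i)
  simpa using this

lemma Gi_nonneg (z : Fin (s+k) → ℝ) : 0 ≤ Gi s k z := by unfold Gi; positivity

lemma Gi_cont : Continuous (Gi s k) := by unfold Gi; fun_prop

lemma Gi_integrable : Integrable (Gi s k) := by
  set m := (Finset.univ.filter (fun p : Fin (s+k) × Fin (s+k) => p.1 < p.2)).card
  have hI : Integrable (fun z : Fin (s+k) → ℝ => ∏ i, (((X^2 + C 2)^(8*m) : ℝ[X]).eval (z i) *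
      Real.exp (-(z i)^2/2))) :=
    Integrable.fintype_prod (f := fun _ x => (((X^2 + C 2)^(8*m) : ℝ[X]).eval x *
      Real.exp (-x^2/2))) (fun _ => integrable_pol2 _)
  refine hI.mono' Gi_cont.aestronglyMeasurable (Filter.Eventually.of_forall fun z => ?_)
  rw [Real.norm_of_nonneg (Gi_nonneg z), Finset.prod_mul_distrib, ← Real.exp_sum, mul_comm]
  unfold Gi
  set P := ∏ i, (z i ^2 + 2) with hP
  have h1 : ∀ i, 1 ≤ z i ^ 2 + 2 := fun i => by nlinarith [sq_nonneg (z i)]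
  have hPi : ∀ i, z i ^ 2 + 2 ≤ P := fun i => by
    rw [hP, ← Finset.mul_prod_erase _ _ (Finset.mem_univ i)]
    have : 1 ≤ ∏ x ∈ Finset.univ.erase i, (z x ^2 + 2) :=
      one_le_prod_aux _ _ h1
    nlinarith [h1 i]
  have hP1 : 1 ≤ P := one_le_prod_aux _ _ h1
  gcongr ?_ * ?_
  · refine Real.exp_le_exp.2 ?_
    rw [← Finset.sum_neg_distrib]
    refine Finset.sum_le_sum fun i _ => ?_
    split_ifs <;> nlinarith [sq_nonneg (z i)]
  · have : ∏ i, ((X^2 + C 2)^(8*m) : ℝ[X]).eval (z i) = (P^8)^m := by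
      simp only [eval_pow, eval_add, eval_X, eval_C]
      rw [Finset.prod_pow, ← hP, pow_mul]
    rw [this, ← Finset.prod_const]
    refine Finset.prod_le_prod (fun p _ => by positivity) fun p _ => ?_
    have hab : |z p.1 - z p.2| ≤ P^2 := by
      have h3 := hPi p.1
      have h4 := hPi p.2
      have h5 := h1 p.1
      have h6 := h1 p.2
      have : |z p.1 - z p.2| ≤ (z p.1 ^2+2) * (z p.2^2+2) := by
        rw [abs_le]
        constructor <;> nlinarith [sq_nonneg (z p.1 - 1), sq_nonneg (z p.2 - 1),
          sq_nonneg (z p.1 + 1), sq_nonneg (z p.2 + 1), mul_nonneg (sq_nonneg (z p.1)) (sq_nonneg (z p.2))]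
      refine this.trans ?_
      rw [sq P]
      exact mul_le_mul h3 h4 (by linarith) (by linarith)
    calc _ ≤ (P^2)^((if (p.1 : ℕ) < s then 1 else 2) * (if (p.2 : ℕ) < s then 1 else 2)) := by
          gcongr
      _ ≤ (P^2)^4 := by
          refine pow_le_pow_right₀ (one_le_pow₀ hP1) ?_
          split_ifs <;> norm_num
      _ = P^8 := by ring

lemma M_zero : M s (0 : Fin k → ℝ) = ENNReal.ofReal (Glg s k) := by
  unfold M
  simp only [fact2]
  rw [← ofReal_integral_eq_lintegral_ofReal Gi_integrable
    (Filter.Eventually.of_forall Gi_nonneg)]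
  rfl

lemma Glg_nonneg : 0 ≤ Glg s k := integral_nonneg (Gi_nonneg (s := s) (k := k))

lemma mp : MeasurePreserving (fun q : (Fin (s+k) → ℝ) × (Fin k → ℝ) => w q.2 q.1) := by
  have h1 : MeasurePreserving (fun q : (Fin (s+k) → ℝ) × (Fin k → ℝ) =>
      (q.1, (fun j => q.1 (Fin.natAdd s j)) + q.2)) (volume.prod volume) (volume.prod volume) :=
    (MeasurePreserving.id volume).skew_product
      (g := fun (z : Fin (s+k) → ℝ) (u : Fin k → ℝ) => (fun j => z (Fin.natAdd s j)) + u)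
      (by fun_prop)
      (Filter.Eventually.of_forall fun z => map_add_left_eq_self volume _)
  have h2 := volume_measurePreserving_sumPiEquivProdPi_symm
    (fun _ : Fin (s+k) ⊕ Fin k => ℝ)
  have h3 := volume_measurePreserving_piCongrLeft (fun _ : Fin (s+k+k) => ℝ)
    (finSumFinEquiv (m := s+k) (n := k))
  have h4 := (h3.comp h2).comp h1
  suffices e : (fun q : (Fin (s+k) → ℝ) × (Fin k → ℝ) => w q.2 q.1) =
    ((MeasurableEquiv.piCongrLeft (fun _ : Fin (s+k+k) => ℝ)
      (finSumFinEquiv (m := s+k) (n := k))) ∘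
        (MeasurableEquiv.sumPiEquivProdPi (fun _ : Fin (s+k) ⊕ Fin k => ℝ)).symm) ∘
      fun q => (q.1, (fun j => q.1 (Fin.natAdd s j)) + q.2) by
    rw [e]; exact h4
  funext q
  funext a
  simp only [Function.comp_apply, MeasurableEquiv.coe_piCongrLeft]
  obtain ⟨b, rfl⟩ := (finSumFinEquiv (m := s+k) (n := k)).surjective a
  rw [Equiv.piCongrLeft_apply_apply]
  rcases b with i | j
  · simp [w, MeasurableEquiv.sumPiEquivProdPi]
  · simp [w, MeasurableEquiv.sumPiEquivProdPi]

noncomputable def phi (A : Set ℝ) (v : ℝ) : ℝ := {v : ℝ | |v| ∈ A}.indicator (fun v => |v|) v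

lemma phi_nonneg (A : Set ℝ) (v : ℝ) : 0 ≤ phi A v :=
  Set.indicator_nonneg (fun _ _ => abs_nonneg _) _

lemma measB (a b : ℝ) : MeasurableSet {v : ℝ | |v| ∈ Set.Ioo a b} :=
  (measurableSet_Ioo (a := a) (b := b)).preimage (f := fun v : ℝ => |v|) (by fun_prop)

lemma phi_meas (a b : ℝ) : Measurable (phi (Set.Ioo a b)) :=
  Measurable.indicator (by fun_prop) (measB a b)

lemma phi_integrable (a b : ℝ) : Integrable (phi (Set.Ioo a b)) := by
  refine (integrable_indicator_iff (measB a b)).2 ?_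
  have : IntegrableOn (fun v : ℝ => |v|) (Set.Icc (-b) b) :=
    Continuous.integrableOn_Icc (by fun_prop)
  refine this.mono_set fun v hv => ?_
  exact abs_le.1 hv.2.le

lemma phi_integral (a b : ℝ) (ha : 0 ≤ a) : ∫ v, phi (Set.Ioo a b) v =
    2 * ∫ u in Set.Ioo a b, u := by
  have h := integral_comp_abs (f := fun v => (Set.Ioo a b).indicator (fun v => v) v)
  have e : (fun v : ℝ => (Set.Ioo a b).indicator (fun v => v) |v|) = phi (Set.Ioo a b) := by
    ext v
    simp [phi, Set.indicator]
  beta_reduce at h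
  rw [← e, h, setIntegral_indicator measurableSet_Ioo]
  congr 3
  ext v
  simp only [Set.mem_inter_iff, Set.mem_Ioi, Set.mem_Ioo]
  constructor
  · exact fun h => h.2
  · exact fun h => ⟨by linarith [h.1], h⟩

/-- integrand of E -/
noncomputable def Wi (m : ℕ) (lam : Fin m → ℝ) : ℝ := Real.exp (-∑ i : Fin m, lam i ^ 2 / 2) *
      ∏ p ∈ Finset.univ.filter (fun p : Fin m × Fin m => p.1 < p.2), |lam p.1 - lam p.2|

lemma E_eq (a b : ℝ) : Eint (s+k+k) k (Set.Ioo a b) =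
    (∫⁻ u : Fin k → ℝ, (∏ j, ENNReal.ofReal (phi (Set.Ioo a b) (u j))) * M s u).toReal := by
  set S := {l : Fin (s+k+k) → ℝ | ∀ j : Fin (s+k+k), s+k+k - k ≤ (j : ℕ) →
      |l j - l ⟨(j : ℕ) - k, Nat.lt_of_le_of_lt (Nat.sub_le _ _) j.isLt⟩| ∈ Set.Ioo a b} with hS
  have hSm : MeasurableSet S := by
    rw [hS]
    simp only [Set.ofPred_forall]
    refine MeasurableSet.iInter fun j => MeasurableSet.iInter fun _ => ?_
    exact (measurableSet_Ioo (a := a) (b := b)).preimage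
      (f := fun l : Fin (s+k+k) → ℝ =>
        |l j - l ⟨(j : ℕ) - k, Nat.lt_of_le_of_lt (Nat.sub_le _ _) j.isLt⟩|) (by fun_prop)
  have hWc : Continuous (Wi (s+k+k)) := by unfold Wi; fun_prop
  have e0 : Eint (s+k+k) k (Set.Ioo a b) = ∫ l in S, Wi (s+k+k) l := rfl
  rw [e0, integral_eq_lintegral_of_nonneg_ae
    (Filter.Eventually.of_forall fun l => by unfold Wi; positivity)
    hWc.aestronglyMeasurable, ← lintegral_indicator hSm]
  congr 1
  have hm : Measurable (S.indicator fun l => ENNReal.ofReal (Wi (s+k+k) l)) :=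
    hWc.measurable.ennreal_ofReal.indicator hSm
  rw [← (mp (s := s) (k := k)).lintegral_comp hm]
  have pt : ∀ q : (Fin (s+k) → ℝ) × (Fin k → ℝ),
      S.indicator (fun l => ENNReal.ofReal (Wi (s+k+k) l)) (w q.2 q.1) =
      (∏ j, ENNReal.ofReal (phi (Set.Ioo a b) (q.2 j))) * ENNReal.ofReal (Phi q.2 q.1) := by
    rintro ⟨z, u⟩
    have key : ∀ j : Fin k, w u z (Fin.natAdd (s+k) j) -
      w u z ⟨((Fin.natAdd (s+k) j : Fin (s+k+k)) : ℕ) - k,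
        Nat.lt_of_le_of_lt (Nat.sub_le _ _) (Fin.natAdd (s+k) j).isLt⟩ = u j := by
      intro j
      have : (⟨((Fin.natAdd (s+k) j : Fin (s+k+k)) : ℕ) - k,
        Nat.lt_of_le_of_lt (Nat.sub_le _ _) (Fin.natAdd (s+k) j).isLt⟩ : Fin (s+k+k)) =
        Fin.castAdd k (Fin.natAdd s j) := by
        ext; simp; omega
      rw [this]; simp [w]
    have hmem : w u z ∈ S ↔ ∀ j, |u j| ∈ Set.Ioo a b := by
      constructor
      · intro h j
        have := h (Fin.natAdd (s+k) j) (by simp)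
        rwa [key] at this
      · intro h j
        refine Fin.addCases (fun i => ?_) (fun i => ?_) j
        · intro hi
          have : s + k + k - k ≤ (i : ℕ) := hi
          have := i.isLt
          omega
        · intro _
          rw [key]; exact h i
    by_cases h : w u z ∈ S
    · rw [Set.indicator_of_mem h]
      have hh : Wi (s+k+k) (w u z) = (∏ j, |u j|) * Phi u z := fact1 u z
      rw [hh, ENNReal.ofReal_mul (Finset.prod_nonneg fun _ _ => abs_nonneg _),
        ENNReal.ofReal_prod_of_nonneg (fun _ _ => abs_nonneg _)]
      congr 1
      refine Finset.prod_congr rfl fun j _ => ?_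
      rw [phi, Set.indicator_of_mem]
      exact hmem.1 h j
    · rw [Set.indicator_of_notMem h]
      rw [hmem] at h
      push Not at h
      obtain ⟨j, hj⟩ := h
      rw [Finset.prod_eq_zero (Finset.mem_univ j), zero_mul]
      rw [phi, Set.indicator_of_notMem, ENNReal.ofReal_zero]
      exact hj
  simp only [pt]
  have hphi := phi_meas a b
  have hPhi : Measurable (fun q : (Fin (s+k) → ℝ) × (Fin k → ℝ) => Phi q.2 q.1) :=
    Phi_cont.measurable
  rw [Measure.volume_eq_prod, lintegral_prod_symm]
  · refine lintegral_congr fun u => ?_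
    dsimp only
    rw [lintegral_const_mul _ (Phi_meas u)]
    rfl
  · exact Measurable.aemeasurable (by fun_prop)

lemma prod_phi (a b : ℝ) (ha : 0 ≤ a) :
    ∫⁻ u : Fin k → ℝ, (∏ j, ENNReal.ofReal (phi (Set.Ioo a b) (u j))) =
      ENNReal.ofReal ((2 * ∫ u in Set.Ioo a b, u) ^ k) := by
  have h := integral_fintype_prod_volume_eq_pow (ι := Fin k) (phi (Set.Ioo a b))
  rw [Fintype.card_fin, phi_integral a b ha] at h
  rw [← h, ofReal_integral_eq_lintegral_ofReal]
  · refine lintegral_congr fun u => ?_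
    rw [ENNReal.ofReal_prod_of_nonneg fun _ _ => phi_nonneg _ _]
  · exact Integrable.fintype_prod (f := fun _ : Fin k => phi (Set.Ioo a b)) fun _ => phi_integrable a b
  · exact Filter.Eventually.of_forall fun u => Finset.prod_nonneg fun _ _ => phi_nonneg _ _

lemma main (a b c d : ℝ) (ha : 0 ≤ a) (hb : b ≤ c) (hd0 : 0 ≤ d)
    (hd : d ≤ 1 - (s+k+k : ℕ) * c^2) :
    d ^ k * (2 * ∫ u in Set.Ioo a b, u) ^ k * Glg s k ≤ Eint (s+k+k) k (Set.Ioo a b) ∧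
    Eint (s+k+k) k (Set.Ioo a b) ≤ (2 * ∫ u in Set.Ioo a b, u) ^ k * Glg s k := by
  have hI0 : 0 ≤ 2 * ∫ u in Set.Ioo a b, u := by
    rw [← phi_integral a b ha]
    exact integral_nonneg (phi_nonneg _)
  have hphi := phi_meas a b
  have hm : Measurable fun u : Fin k → ℝ => ∏ j, ENNReal.ofReal (phi (Set.Ioo a b) (u j)) := by
    fun_prop
  have hst : ∀ u : Fin k → ℝ, (∏ j, ENNReal.ofReal (phi (Set.Ioo a b) (u j))) ≠ 0 →
      ∀ j, d ≤ 1 - (s+k+k : ℕ) * (u j)^2 := by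
    intro u hu j
    have h1 := Finset.prod_ne_zero_iff.1 hu j (Finset.mem_univ j)
    have h2 : |u j| ∈ Set.Ioo a b := by
      by_contra h
      apply h1
      rw [phi, Set.indicator_of_notMem, ENNReal.ofReal_zero]
      exact h
    have h3 : (u j)^2 ≤ c^2 := sq_le_sq' (by linarith [(abs_lt.1 h2.2).1])
      (by linarith [(abs_lt.1 h2.2).2])
    have h4 : (0:ℝ) ≤ (s+k+k : ℕ) := Nat.cast_nonneg _
    nlinarith
  set L := ∫⁻ u : Fin k → ℝ, (∏ j, ENNReal.ofReal (phi (Set.Ioo a b) (u j))) * M s u with hL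
  have hup : L ≤ ENNReal.ofReal ((2 * ∫ u in Set.Ioo a b, u) ^ k * Glg s k) := by
    rw [ENNReal.ofReal_mul (by positivity), ← prod_phi a b ha, ← M_zero, ← lintegral_mul_const _ hm]
    refine lintegral_mono fun u => ?_
    by_cases h : (∏ j, ENNReal.ofReal (phi (Set.Ioo a b) (u j))) = 0
    · simp [h]
    · dsimp only
      gcongr
      exact (steps u d (hst u h)).1
  have hlo : ENNReal.ofReal (d ^ k * (2 * ∫ u in Set.Ioo a b, u) ^ k * Glg s k) ≤ L := by
    rw [mul_comm (d^k), mul_assoc, ENNReal.ofReal_mul (by positivity), ← prod_phi a b ha,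
      ENNReal.ofReal_mul (by positivity), ENNReal.ofReal_pow hd0,
      ← M_zero, ← lintegral_mul_const _ hm]
    refine lintegral_mono fun u => ?_
    by_cases h : (∏ j, ENNReal.ofReal (phi (Set.Ioo a b) (u j))) = 0
    · simp [h]
    · dsimp only
      gcongr
      exact (steps u d (hst u h)).2
  have hfin : L ≠ ⊤ := ne_top_of_le_ne_top ENNReal.ofReal_ne_top hup
  rw [E_eq]
  exact ⟨(ENNReal.ofReal_le_iff_le_toReal hfin).1 hlo,
    ENNReal.toReal_le_of_le_ofReal (mul_nonneg (by positivity) Glg_nonneg) hup⟩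

end fin

end LG

theorem stmt18 (n k : ℕ) (hk : 0 < k) (hn : 2 * k < n)
    (c₁ a b : ℝ) (hc : 0 < c₁) (hnc : 2 * n * c₁ ^ 2 < 1)
    (ha : 0 ≤ a) (hb : b ≤ c₁) :
    (1 - n * c₁ ^ 2) ^ k * (2 * ∫ u in Set.Ioo a b, u) ^ k * Glg (n - 2 * k) k ≤
      Eint n k (Set.Ioo a b) ∧
    Eint n k (Set.Ioo a b) ≤ (2 * ∫ u in Set.Ioo a b, u) ^ k * Glg (n - 2 * k) k := by
  obtain ⟨s, rfl⟩ : ∃ s, n = s + k + k := ⟨n - 2 * k, by omega⟩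
  have e : s + k + k - 2 * k = s := by omega
  rw [e]
  exact LG.main a b c₁ _ ha hb (by nlinarith) le_rfl
end
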